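/- Let q ∈ {a,b}^* contain every word of length n−1 over {a,b} as a factor, let h = ⌊n²/4⌋, let u = q^h a q^h and v = q^h b q^h. Then the plactic monoid of rank n satisfies the semigroup identity u[a ↦ ab, b ↦ ba] = v[a ↦ ab, b ↦ ba]: for all X, Y in P_n, substituting ab ↦ XY and ba ↦ YX into u and v yields equal elements. -/

import Mathlib

/-- The Knuth relations on the free monoid over [n]. -/
def knuthRel (n : ℕ) (x y : FreeMonoid (Fin n)) : Prop :=
  (∃ a b c : Fin n, a < b ∧ b ≤ c ∧
    x = FreeMonoid.of b * FreeMonoid.of c * FreeMonoid.of a ∧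
    y = FreeMonoid.of b * FreeMonoid.of a * FreeMonoid.of c) ∨
  (∃ a b c : Fin n, a ≤ b ∧ b < c ∧
    x = FreeMonoid.of c * FreeMonoid.of a * FreeMonoid.of b ∧
    y = FreeMonoid.of a * FreeMonoid.of c * FreeMonoid.of b)

/-- The plactic monoid of rank n. -/
abbrev Plactic (n : ℕ) := (conGen (knuthRel n)).Quotient


namespace PlacticId

/-- every word of length `d` occurs as a factor inside the window `[lo, hi)` -/
def Univ (d : ℕ) (e : ℤ → Bool) (lo hi : ℤ) : Prop :=
  ∀ p : ℕ → Bool, ∃ b : ℤ, lo ≤ b ∧ b + d ≤ hi ∧ ∀ i : ℕ, i < d → e (b + i) = p i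

theorem Univ.neg {d : ℕ} {e : ℤ → Bool} {lo hi : ℤ} (h : Univ d e lo hi) :
    Univ d (fun z => e (-z)) (1 - hi) (1 - lo) := by
  intro p
  obtain ⟨b, h1, h2, h3⟩ := h (fun i => p (d - 1 - i))
  refine ⟨1 - (b + d), by omega, by omega, ?_⟩
  intro i hi
  have := h3 (d - 1 - i) (by omega)
  simp only at this ⊢
  have e1 : d - 1 - (d - 1 - i) = i := by omega
  rw [e1] at this
  rw [← this]
  congr 1
  omega

/-- lexicographic monotonicity of (block, offset) -/
def LexMono {α : Type*} [PartialOrder α] (t o : α → ℤ) : Prop :=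
  ∀ x y, x ≤ y → t x < t y ∨ (t x = t y ∧ o x ≤ o y)

theorem layer {α : Type*} (A : Finset α) (δ : α → ℤ) (g : α → ℤ)
    (h0 : ∀ x ∈ A, 0 ≤ δ x)
    (h : ∀ s : ℤ, 0 ≤ ∑ x ∈ A.filter (fun x => s ≤ δ x), g x) :
    0 ≤ ∑ x ∈ A, δ x * g x := by
  classical
  obtain ⟨M, hM⟩ : ∃ M : ℕ, ∀ x ∈ A, δ x ≤ M := by
    refine ⟨(A.sup fun x => (δ x).toNat), fun x hx => ?_⟩
    have : (δ x).toNat ≤ A.sup fun x => (δ x).toNat := Finset.le_sup (f := fun x => (δ x).toNat) hx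
    omega
  have key : ∀ x ∈ A, δ x = ∑ s ∈ Finset.range M, if ((s : ℤ) + 1 ≤ δ x) then (1 : ℤ) else 0 := by
    intro x hx
    rw [Finset.sum_ite, Finset.sum_const, Finset.sum_const_zero, add_zero, nsmul_eq_mul, mul_one]
    have : (Finset.range M).filter (fun s : ℕ => (s : ℤ) + 1 ≤ δ x) = Finset.range (δ x).toNat := by
      ext s
      have := hM x hx
      simp only [Finset.mem_filter, Finset.mem_range]
      omega
    rw [this, Finset.card_range]
    have := h0 x hx
    omega
  have : ∑ x ∈ A, δ x * g x = ∑ s ∈ Finset.range M,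
      ∑ x ∈ A.filter (fun x => ((s : ℤ) + 1) ≤ δ x), g x := by
    have e1 : ∑ x ∈ A, δ x * g x = ∑ x ∈ A, ∑ s ∈ Finset.range M,
        if ((s : ℤ) + 1 ≤ δ x) then g x else 0 := by
      refine Finset.sum_congr rfl fun x hx => ?_
      conv_lhs => rw [key x hx]
      rw [Finset.sum_mul]
      refine Finset.sum_congr rfl fun s _ => ?_
      split_ifs <;> simp
    rw [e1, Finset.sum_comm]
    refine Finset.sum_congr rfl fun s _ => ?_
    rw [Finset.sum_filter]
  rw [this]
  exact Finset.sum_nonneg fun s _ => h _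

/-- the one-cluster step -/
theorem step {α : Type*} [PartialOrder α] [Fintype α] [DecidableEq α]
    (g : α → ℤ) (d : ℕ) (e : ℤ → Bool) (lo hi : ℤ) (hU : Univ d e lo hi)
    (D I : Finset α) (hD : IsLowerSet (D : Set α)) (hI : IsLowerSet (I : Set α)) (hDI : D ⊆ I)
    (hcard : (I \ D).card ≤ d)
    (hup : ∀ J : Finset α, IsLowerSet (J : Set α) → D ⊆ J → J ⊆ I → 0 ≤ ∑ x ∈ I \ J, g x)
    (t o : α → ℤ) (hm : LexMono t o) (hDt : ∀ x ∈ D, t x < lo) :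
    ∃ t' : α → ℤ, LexMono t' o ∧ (∀ x, e (t' x) = e (t x)) ∧ (∀ x, t' x ≤ t x) ∧
      (∀ x, min lo (t x) ≤ t' x) ∧ (∀ x ∈ I, t' x < hi) ∧ (∀ x, x ∉ I → t' x = t x) ∧
      ∑ x, t' x * g x ≤ ∑ x, t x * g x := by
  classical
  set V := (I \ D).image t with hV
  have hVc : V.card ≤ d := le_trans Finset.card_image_le hcard
  let rk : ℤ → ℕ := fun z => (V.filter (fun v => v < z)).card
  have rk_lt : ∀ v ∈ V, rk v < d := by
    intro v hv
    refine lt_of_lt_of_le (Finset.card_lt_card ?_) hVc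
    refine Finset.ssubset_iff_subset_ne.2 ⟨Finset.filter_subset _ _, fun h => ?_⟩
    rw [← h] at hv
    simp at hv
  have rk_mono : ∀ v w, v ≤ w → rk v ≤ rk w := by
    intro v w h
    refine Finset.card_le_card fun z hz => ?_
    simp only [Finset.mem_filter] at hz ⊢
    exact ⟨hz.1, by omega⟩
  have rk_strict : ∀ v ∈ V, ∀ w, v < w → rk v < rk w := by
    intro v hv w h
    refine Finset.card_lt_card (Finset.ssubset_iff_subset_ne.2 ⟨fun z hz => ?_, fun h' => ?_⟩)
    · simp only [Finset.mem_filter] at hz ⊢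
      exact ⟨hz.1, by omega⟩
    · have : v ∈ V.filter (fun z => z < w) := by simp [hv, h]
      rw [← h'] at this
      simp at this
  have rk_lip : ∀ v w, v ≤ w → (rk w : ℤ) ≤ rk v + (w - v) := by
    intro v w h
    have : V.filter (fun z => z < w) ⊆ V.filter (fun z => z < v) ∪ Finset.Ico v w := by
      intro z hz
      simp only [Finset.mem_filter, Finset.mem_union, Finset.mem_Ico] at hz ⊢
      by_cases hzv : z < v
      · exact Or.inl ⟨hz.1, hzv⟩
      · exact Or.inr ⟨by omega, hz.2⟩
    have h2 := (Finset.card_le_card this).trans (Finset.card_union_le _ _)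
    rw [Int.card_Ico] at h2
    have : rk w ≤ rk v + (w - v).toNat := h2
    omega
  have rk_inj : ∀ v ∈ V, ∀ w ∈ V, rk v = rk w → v = w := by
    intro v hv w hw h
    rcases lt_trichotomy v w with h1 | h1 | h1
    · have := rk_strict v hv w h1; omega
    · exact h1
    · have := rk_strict w hw v h1; omega
  obtain ⟨b, hb1, hb2, hb3⟩ := hU (fun i => decide (∃ v ∈ V, rk v = i ∧ e v = true))
  have hev : ∀ v ∈ V, e (b + rk v) = e v := by
    intro v hv
    rw [hb3 _ (rk_lt v hv)]
    cases hh : e v with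
    | true => simp only [decide_eq_true_eq]; exact ⟨v, hv, rfl, hh⟩
    | false =>
      simp only [decide_eq_false_iff_not]
      rintro ⟨w, hw, hr, hwt⟩
      rw [rk_inj w hw v hv hr] at hwt
      rw [hh] at hwt; exact absurd hwt (by simp)
  have hVm : ∀ x, x ∈ I → x ∉ D → t x ∈ V := by
    intro x hx hx'
    exact Finset.mem_image_of_mem _ (by simp [hx, hx'])
  let t' : α → ℤ := fun x => if x ∈ I ∧ x ∉ D then min (t x) (b + rk (t x)) else t x
  have t'in : ∀ x, x ∈ I → x ∉ D → t' x = min (t x) (b + rk (t x)) := by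
    intro x h1 h2; simp [t', h1, h2]
  have t'D : ∀ x, x ∈ D → t' x = t x := by intro x h1; simp [t', h1]
  have t'I : ∀ x, x ∉ I → t' x = t x := by intro x h1; simp [t', h1]
  have t'le : ∀ x, t' x ≤ t x := by
    intro x; simp only [t']; split_ifs
    · exact min_le_left _ _
    · exact le_rfl
  refine ⟨t', ?_, ?_, t'le, ?_, ?_, t'I, ?_⟩
  · intro x y hxy
    have hxy' := hm x y hxy
    by_cases hyD : y ∈ D
    · have hxD : x ∈ D := hD hxy hyD
      rw [t'D x hxD, t'D y hyD]; exact hxy'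
    by_cases hyI : y ∈ I
    · have hxI : x ∈ I := hI hxy hyI
      rw [t'in y hyI hyD]
      by_cases hxD : x ∈ D
      · rw [t'D x hxD]
        have := hDt x hxD
        rcases hxy' with h | ⟨h, h'⟩
        · left; refine lt_min h ?_; omega
        · by_cases h3 : t y ≤ b + rk (t y)
          · right; rw [min_eq_left h3]; exact ⟨h, h'⟩
          · left; refine lt_min ?_ ?_ <;> omega
      · rw [t'in x hxI hxD]
        rcases hxy' with h | ⟨h, h'⟩
        · left
          have := rk_strict _ (hVm x hxI hxD) _ h
          omega
        · right; rw [h]; exact ⟨rfl, h'⟩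
    · rw [t'I y hyI]
      have := t'le x
      rcases hxy' with h | ⟨h, h'⟩
      · left; omega
      · by_cases h3 : t' x = t y
        · right; exact ⟨h3, h'⟩
        · left; omega
  · intro x
    simp only [t']
    split_ifs with h
    · rcases min_choice (t x) (b + rk (t x)) with h1 | h1
      · rw [h1]
      · rw [h1]; exact hev _ (hVm x h.1 h.2)
    · rfl
  · intro x
    simp only [t']
    split_ifs with h <;> omega
  · intro x hx
    by_cases hxD : x ∈ D
    · rw [t'D x hxD]
      have := hDt x hxD
      omega
    · rw [t'in x hx hxD]
      have := rk_lt _ (hVm x hx hxD)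
      omega
  · have hsub : ∑ x, t x * g x - ∑ x, t' x * g x = ∑ x ∈ I \ D, (t x - t' x) * g x := by
      rw [← Finset.sum_sub_distrib]
      symm
      refine (Finset.sum_subset (Finset.subset_univ _) ?_).trans
        (Finset.sum_congr rfl fun x _ => by ring)
      intro x _ hx
      have : t' x = t x := by
        by_cases h1 : x ∈ I
        · have : x ∈ D := by simpa [h1] using hx
          exact t'D x this
        · exact t'I x h1
      rw [this]; ring
    have hnn : 0 ≤ ∑ x ∈ I \ D, (t x - t' x) * g x := by
      apply layer
      · intro x _; have := t'le x; omega
      · intro s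
        have := hup (D ∪ (I \ D).filter (fun x => ¬ s ≤ t x - t' x)) ?_ Finset.subset_union_left ?_
        · refine this.trans_eq (Finset.sum_congr ?_ fun _ _ => rfl)
          ext x
          simp only [Finset.mem_filter, Finset.mem_sdiff, Finset.mem_union]
          tauto
        · intro y x hxy hy
          simp only [Finset.coe_union, Finset.coe_filter, Set.mem_union, Finset.mem_coe,
            Set.mem_ofPred_eq, Finset.mem_sdiff] at hy ⊢
          by_cases hxD : x ∈ D
          · exact Or.inl hxD
          · have hyD : y ∉ D := fun h => hxD (hD hxy h)
            rcases hy with hy | ⟨⟨hyI, _⟩, hs⟩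
            · exact absurd hy hyD
            have hxI : x ∈ I := hI hxy hyI
            refine Or.inr ⟨⟨hxI, hxD⟩, ?_⟩
            rw [t'in x hxI hxD]
            rw [t'in y hyI hyD] at hs
            have htxy : t x ≤ t y := by rcases hm x y hxy with h | h <;> omega
            have := rk_lip _ _ htxy
            omega
        · refine Finset.union_subset hDI ((Finset.filter_subset _ _).trans Finset.sdiff_subset)
    omega

/-- iterate the step over `r` windows -/
theorem sweep {α : Type*} [PartialOrder α] [Fintype α] [DecidableEq α]
    (g : α → ℤ) (d : ℕ) (e : ℤ → Bool) (L : ℤ) (hL : 0 ≤ L)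
    (hrib : ∀ D I : Finset α, IsLowerSet (D : Set α) → IsLowerSet (I : Set α) → D ⊆ I →
      (∀ J : Finset α, IsLowerSet (J : Set α) → D ⊂ J → J ⊂ I →
        ∑ x ∈ J, g x < ∑ x ∈ D, g x ∧ ∑ x ∈ J, g x < ∑ x ∈ I, g x) → (I \ D).card ≤ d) :
    ∀ (r : ℕ) (lo : ℤ), (∀ j : ℕ, j < r → Univ d e (lo + j * L) (lo + (j + 1) * L)) →
    ∀ (D : Finset α), IsLowerSet (D : Set α) → (Finset.univ \ D).card ≤ r →
    ∀ (t o : α → ℤ), LexMono t o → (∀ x ∈ D, t x < lo) →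
    ∃ (t' : α → ℤ) (M : Finset α), IsLowerSet (M : Set α) ∧ D ⊆ M ∧
      LexMono t' o ∧ (∀ x, e (t' x) = e (t x)) ∧ (∀ x, t' x ≤ t x) ∧
      (∀ x, min lo (t x) ≤ t' x) ∧ (∀ x ∈ M, t' x < lo + r * L) ∧ (∀ x, x ∉ M → t' x = t x) ∧
      ∑ x, t' x * g x ≤ ∑ x, t x * g x ∧
      (∀ J : Finset α, IsLowerSet (J : Set α) → M ⊂ J → ∑ x ∈ J, g x < ∑ x ∈ M, g x) := by
  classical
  intro r
  induction r with
  | zero =>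
    intro lo _ D hD hc t o hm hDt
    refine ⟨t, D, hD, le_rfl, hm, fun _ => rfl, fun _ => le_rfl, fun _ => min_le_right _ _, ?_,
      fun _ _ => rfl, le_rfl, ?_⟩
    · intro x hx; simpa using hDt x hx
    · intro J _ hJ
      exfalso
      obtain ⟨x, _, hx⟩ := Finset.exists_of_ssubset hJ
      have : Finset.univ \ D = ∅ := Finset.card_eq_zero.1 (by omega)
      have hx' : x ∈ Finset.univ \ D := by simp [hx]
      rw [this] at hx'; simp at hx'
  | succ r ih =>
    intro lo hU D hD hc t o hm hDt
    by_cases hT : ∀ J : Finset α, IsLowerSet (J : Set α) → D ⊂ J → ∑ x ∈ J, g x < ∑ x ∈ D, g x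
    · refine ⟨t, D, hD, le_rfl, hm, fun _ => rfl, fun _ => le_rfl, fun _ => min_le_right _ _, ?_,
        fun _ _ => rfl, le_rfl, hT⟩
      intro x hx
      have := hDt x hx
      have h2 : 0 ≤ ((r + 1 : ℕ) : ℤ) * L := by positivity
      omega
    · push Not at hT
      obtain ⟨J0, hJ0, hDJ0, hg0⟩ := hT
      let F : Finset (Finset α) := Finset.univ.filter
        (fun J => IsLowerSet (J : Set α) ∧ D ⊂ J ∧ ∑ x ∈ D, g x ≤ ∑ x ∈ J, g x)
      obtain ⟨I, hIF, hImin⟩ := Finset.exists_min_image F Finset.card ⟨J0, by simp [F, hJ0, hDJ0, hg0]⟩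
      simp only [F, Finset.mem_filter, Finset.mem_univ, true_and] at hIF hImin
      obtain ⟨hI, hDI, hgI⟩ := hIF
      have hlt : ∀ J : Finset α, IsLowerSet (J : Set α) → D ⊂ J → J ⊂ I →
          ∑ x ∈ J, g x < ∑ x ∈ D, g x := by
        intro J hJ h1 h2
        by_contra hcon
        have := hImin J ⟨hJ, h1, not_lt.1 hcon⟩
        have := Finset.card_lt_card h2
        omega
      have hcard := hrib D I hD hI hDI.subset
        (fun J hJ h1 h2 => ⟨hlt J hJ h1 h2, (hlt J hJ h1 h2).trans_le hgI⟩)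
      have hup : ∀ J : Finset α, IsLowerSet (J : Set α) → D ⊆ J → J ⊆ I →
          0 ≤ ∑ x ∈ I \ J, g x := by
        intro J hJ h1 h2
        rw [Finset.sum_sdiff_eq_sub h2]
        rcases eq_or_ne J I with rfl | h3
        · simp
        rcases eq_or_ne D J with rfl | h4
        · omega
        have := hlt J hJ (h1.ssubset_of_ne h4) (h2.ssubset_of_ne h3)
        omega
      have hU0 := hU 0 (by omega)
      simp only [Nat.cast_zero, zero_mul, add_zero, zero_add, one_mul] at hU0
      obtain ⟨t1, hm1, he1, hle1, hlo1, hI1, hout1, hs1⟩ :=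
        step g d e lo (lo + L) hU0 D I hD hI hDI.subset hcard hup t o hm hDt
      have hc2 : (Finset.univ \ I).card ≤ r := by
        have : Finset.univ \ I ⊂ Finset.univ \ D := by
          obtain ⟨x, hx, hx'⟩ := Finset.exists_of_ssubset hDI
          refine Finset.ssubset_iff_subset_ne.2 ⟨Finset.sdiff_subset_sdiff le_rfl hDI.subset, fun h => ?_⟩
          have : x ∈ Finset.univ \ D := by simp [hx']
          rw [← h] at this
          simp [hx] at this
        have := Finset.card_lt_card this
        omega
      obtain ⟨t2, M, hM, hIM, hm2, he2, hle2, hlo2, hM2, hout2, hs2, hterm⟩ :=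
        ih (lo + L) (fun j hj => by
          have := hU (j + 1) (by omega)
          convert this using 1 <;> push_cast <;> ring) I hI hc2 t1 o hm1 hI1
      refine ⟨t2, M, hM, hDI.subset.trans hIM, hm2, fun x => (he2 x).trans (he1 x),
        fun x => (hle2 x).trans (hle1 x), ?_, ?_, ?_, hs2.trans hs1, hterm⟩
      · intro x
        have h1 := hlo1 x
        have h2 := hlo2 x
        omega
      · intro x hx
        have h1 := hM2 x hx
        push_cast
        linarith
      · intro x hx
        rw [hout2 x hx, hout1 x (fun h => hx (hIM h))]

/-- all cells can be moved away from the centre block `c` -/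
theorem opt {α : Type*} [PartialOrder α] [Fintype α] [DecidableEq α]
    (g : α → ℤ) (d : ℕ) (e : ℤ → Bool) (L : ℤ) (hL : 0 ≤ L)
    (hrib : ∀ D I : Finset α, IsLowerSet (D : Set α) → IsLowerSet (I : Set α) → D ⊆ I →
      (∀ J : Finset α, IsLowerSet (J : Set α) → D ⊂ J → J ⊂ I →
        ∑ x ∈ J, g x < ∑ x ∈ D, g x ∧ ∑ x ∈ J, g x < ∑ x ∈ I, g x) → (I \ D).card ≤ d)
    (r : ℕ) (hr : Fintype.card α ≤ r)
    (hU1 : ∀ j : ℕ, j < r → Univ d e (j * L) ((j + 1) * L))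
    (hU2 : ∀ j : ℕ, j < r → Univ d e (r * L + 1 + j * L) (r * L + 1 + (j + 1) * L))
    (t o : α → ℤ) (hm : LexMono t o) (ht0 : ∀ x, 0 ≤ t x) (htN : ∀ x, t x ≤ 2 * r * L + 1) :
    ∃ t' : α → ℤ, LexMono t' o ∧ (∀ x, e (t' x) = e (t x)) ∧ (∀ x, 0 ≤ t' x) ∧
      (∀ x, t' x ≤ max (2 * r * L) (t x)) ∧ (∀ x, t' x ≠ r * L) ∧
      ∑ x, t' x * g x ≤ ∑ x, t x * g x := by
  classical
  obtain ⟨t1, M, hM, -, hm1, he1, hle1, hlo1, hM1, hout1, hs1, hterm1⟩ :=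
    sweep g d e L hL hrib r 0 (by simpa using hU1) ∅ (by simp [IsLowerSet]) (by simpa using hr)
      t o hm (by simp)
  have hlow : ∀ A : Finset αᵒᵈ, IsLowerSet (A : Set αᵒᵈ) →
      IsLowerSet ((Finset.univ.filter (fun x : α => OrderDual.toDual x ∉ A) : Finset α) : Set α) := by
    intro A hA x y hxy hx
    simp only [Finset.coe_filter, Finset.mem_univ, true_and, Set.mem_ofPred_eq] at hx ⊢
    exact fun h => hx (hA (show OrderDual.toDual x ≤ OrderDual.toDual y from hxy) h)
  have hrib' : ∀ D I : Finset αᵒᵈ, IsLowerSet (D : Set αᵒᵈ) → IsLowerSet (I : Set αᵒᵈ) → D ⊆ I →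
      (∀ J : Finset αᵒᵈ, IsLowerSet (J : Set αᵒᵈ) → D ⊂ J → J ⊂ I →
        ∑ x ∈ J, (fun x => - g (OrderDual.ofDual x)) x < ∑ x ∈ D, (fun x => - g (OrderDual.ofDual x)) x ∧
        ∑ x ∈ J, (fun x => - g (OrderDual.ofDual x)) x < ∑ x ∈ I, (fun x => - g (OrderDual.ofDual x)) x) →
      (I \ D).card ≤ d := by
    intro D I hD hI hDI hJ
    have compl_sum : ∀ A : Finset αᵒᵈ, ∑ y ∈ A, - g (OrderDual.ofDual y) =
        ∑ y ∈ Finset.univ.filter (fun x : α => OrderDual.toDual x ∉ A), g y - ∑ y, g y := by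
      intro A
      rw [Finset.sum_neg_distrib, ← Finset.sum_filter_add_sum_filter_not Finset.univ
        (fun x : α => OrderDual.toDual x ∈ A) g]
      have : ∑ y ∈ A, g (OrderDual.ofDual y) =
          ∑ y ∈ Finset.univ.filter (fun x : α => OrderDual.toDual x ∈ A), g y := by
        refine Finset.sum_bij (fun y _ => OrderDual.ofDual y) ?_ ?_ ?_ ?_
        · intro y hy; simpa using hy
        · intro a _ b _ h; exact h
        · intro y hy; exact ⟨OrderDual.toDual y, by simpa using hy, rfl⟩
        · intro y _; rfl
      rw [this]; ring
    have := hrib (Finset.univ.filter (fun x : α => OrderDual.toDual x ∉ I))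
      (Finset.univ.filter (fun x : α => OrderDual.toDual x ∉ D)) (hlow I hI) (hlow D hD) ?_ ?_
    · refine le_trans (le_of_eq ?_) this
      refine Finset.card_bij (fun y _ => OrderDual.ofDual y) ?_ ?_ ?_
      · intro y hy
        simp only [Finset.mem_sdiff, Finset.mem_filter, Finset.mem_univ, true_and,
          OrderDual.toDual_ofDual] at hy ⊢
        tauto
      · intro a _ b _ h; exact h
      · intro y hy
        refine ⟨OrderDual.toDual y, ?_, rfl⟩
        simp only [Finset.mem_sdiff, Finset.mem_filter, Finset.mem_univ, true_and] at hy ⊢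
        tauto
    · intro x hx
      simp only [Finset.mem_filter, Finset.mem_univ, true_and] at hx ⊢
      exact fun h => hx (hDI h)
    · intro J hJl h1 h2
      set J' : Finset αᵒᵈ := Finset.univ.filter (fun y : αᵒᵈ => OrderDual.ofDual y ∉ J) with hJ'
      have hJJ : Finset.univ.filter (fun x : α => OrderDual.toDual x ∉ J') = J := by
        ext x; simp [hJ']
      have hh := hJ J' (by
        intro y z hyz hy
        simp only [hJ', Finset.coe_filter, Finset.mem_univ, true_and, Set.mem_ofPred_eq] at hy ⊢
        exact fun h => hy (hJl (show OrderDual.ofDual y ≤ OrderDual.ofDual z from hyz) h)) ?_ ?_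
      · rw [compl_sum, compl_sum, compl_sum, hJJ] at hh
        constructor <;> linarith [hh.1, hh.2]
      · obtain ⟨x, hx, hx'⟩ := Finset.exists_of_ssubset h2
        refine Finset.ssubset_iff_subset_ne.2 ⟨fun y hy => ?_, fun h => ?_⟩
        · simp only [hJ', Finset.mem_filter, Finset.mem_univ, true_and]
          intro hyJ
          have := h2.subset hyJ
          simp [hy] at this
        · have h3 : OrderDual.toDual x ∈ J' := by simp [hJ', hx']
          rw [← h] at h3
          simp [h3] at hx
      · obtain ⟨x, hx, hx'⟩ := Finset.exists_of_ssubset h1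
        refine Finset.ssubset_iff_subset_ne.2 ⟨fun y hy => ?_, fun h => ?_⟩
        · simp only [hJ', Finset.mem_filter, Finset.mem_univ, true_and] at hy
          by_contra hyI
          exact hy (h1.subset (by simp [hyI]))
        · have h3 : OrderDual.toDual x ∈ I := by simpa using hx'
          rw [← h] at h3
          simp [hJ', hx] at h3
  have hU' : ∀ j : ℕ, j < r → Univ d (fun z => e (-z)) (-(2 * r * L) + j * L)
      (-(2 * r * L) + (j + 1) * L) := by
    intro j hj
    have := (hU2 (r - 1 - j) (by omega)).neg
    have hc : ((r - 1 - j : ℕ) : ℤ) = r - 1 - j := by omega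
    rw [hc] at this
    convert this using 1 <;> ring
  have hmono' : LexMono (α := αᵒᵈ) (fun x => - t1 (OrderDual.ofDual x))
      (fun x => - o (OrderDual.ofDual x)) := by
    intro x y hxy
    have := hm1 (OrderDual.ofDual y) (OrderDual.ofDual x) hxy
    simp only
    rcases this with h | h
    · left; omega
    · right; omega

  obtain ⟨t2, R, hR, -, hm2, he2, hle2, hlo2, hM2, hout2, hs2, hterm2⟩ :=
    sweep (α := αᵒᵈ) (fun x => - g (OrderDual.ofDual x)) d (fun z => e (-z)) L hL hrib' r
      (-(2 * r * L)) hU' ∅ (by simp [IsLowerSet]) (by simpa using hr)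
      (fun x => - t1 (OrderDual.ofDual x)) (fun x => - o (OrderDual.ofDual x)) hmono' (by simp)
  refine ⟨fun x => - t2 (OrderDual.toDual x), ?_, ?_, ?_, ?_, ?_, ?_⟩
  · intro x y hxy
    have := hm2 (OrderDual.toDual y) (OrderDual.toDual x) hxy
    simp only [OrderDual.ofDual_toDual] at this
    beta_reduce
    rcases this with h | h
    · left; omega
    · right; omega
  · intro x
    have := he2 (OrderDual.toDual x)
    simp only [OrderDual.ofDual_toDual, neg_neg] at this
    rw [this, he1]
  · intro x
    beta_reduce
    have h1 := hle2 (OrderDual.toDual x)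
    have h2 := hlo1 x
    have h3 := ht0 x
    simp only [OrderDual.ofDual_toDual] at h1
    omega
  · intro x
    beta_reduce
    have h1 := hlo2 (OrderDual.toDual x)
    have h2 := hle1 x
    have h3 := htN x
    simp only [OrderDual.ofDual_toDual] at h1
    omega
  · intro x
    beta_reduce
    by_cases hx : OrderDual.toDual x ∈ R
    · have := hM2 _ hx
      intro h
      nlinarith
    · have h1 := hout2 _ hx
      simp only [OrderDual.ofDual_toDual] at h1
      rw [h1, neg_neg]
      by_cases hxM : x ∈ M
      · have := hM1 x hxM
        intro h
        omega
      · exfalso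
        set R' : Finset α := Finset.univ.filter (fun x : α => OrderDual.toDual x ∉ R) with hR'
        have hR'low := hlow R hR
        have hxR' : x ∈ R' := by simp [hR', hx]
        have a1 := hterm1 (M ∪ R') (by
          rw [Finset.coe_union]; exact hM.union hR'low)
          (Finset.ssubset_iff_subset_ne.2 ⟨Finset.subset_union_left, fun h => hxM (by
            rw [h]; exact Finset.mem_union_right _ hxR')⟩)
        set K : Finset αᵒᵈ := Finset.univ.filter (fun y : αᵒᵈ => OrderDual.ofDual y ∉ M ∩ R') with hK
        have a2 := hterm2 K (by
          intro y z hyz hy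
          simp only [hK, Finset.coe_filter, Finset.mem_univ, true_and, Set.mem_ofPred_eq,
            Finset.mem_inter, not_and_or] at hy ⊢
          rcases hy with hy | hy
          · exact Or.inl fun h => hy (hM (show OrderDual.ofDual y ≤ OrderDual.ofDual z from hyz) h)
          · exact Or.inr fun h => hy (hR'low (show OrderDual.ofDual y ≤ OrderDual.ofDual z from hyz) h))
          (by
            refine Finset.ssubset_iff_subset_ne.2 ⟨fun y hy => ?_, fun h => hx ?_⟩
            · simp [hK, hR', hy]
            · rw [h]; simp [hK, hxM])
        have s1 : ∑ y ∈ K, - g (OrderDual.ofDual y) = - ∑ y ∈ (M ∩ R')ᶜ, g y := by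
          rw [Finset.sum_neg_distrib]
          congr 1
          refine Finset.sum_bij (fun y _ => OrderDual.ofDual y) ?_ ?_ ?_ ?_
          · intro y hy; rw [hK, Finset.mem_filter] at hy; exact Finset.mem_compl.2 hy.2
          · intro a _ b _ h; exact h
          · intro y hy; exact ⟨OrderDual.toDual y, by
              rw [hK, Finset.mem_filter]; exact ⟨Finset.mem_univ _, Finset.mem_compl.1 hy⟩, rfl⟩
          · intro y _; rfl
        have s2 : ∑ y ∈ R, - g (OrderDual.ofDual y) = - ∑ y ∈ R'ᶜ, g y := by
          rw [Finset.sum_neg_distrib]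
          congr 1
          refine Finset.sum_bij (fun y _ => OrderDual.ofDual y) ?_ ?_ ?_ ?_
          · intro y hy; simpa [hR'] using hy
          · intro a _ b _ h; exact h
          · intro y hy; exact ⟨OrderDual.toDual y, by simpa [hR'] using hy, rfl⟩
          · intro y _; rfl
        rw [s1, s2] at a2
        have b1 := Finset.sum_add_sum_compl (M ∩ R') g
        have b2 := Finset.sum_add_sum_compl R' g
        have b3 := Finset.sum_union_inter (s₁ := M) (s₂ := R') (f := g)
        linarith
  · refine le_trans (le_of_eq ?_) (le_trans hs2 (le_trans (le_of_eq ?_) hs1))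
    · refine Finset.sum_bij (fun y _ => OrderDual.toDual y) ?_ ?_ ?_ ?_
      · intro y _; simp
      · intro a _ b _ h; exact h
      · intro y _; exact ⟨OrderDual.ofDual y, by simp, rfl⟩
      · intro y _; simp
    · refine Finset.sum_bij (fun y _ => OrderDual.ofDual y) ?_ ?_ ?_ ?_
      · intro y _; simp
      · intro a _ b _ h; exact h
      · intro y _; exact ⟨OrderDual.toDual y, by simp, rfl⟩
      · intro y _; simp

end PlacticId

namespace PlacticId

/-- ribbon lemma for the grid of cells -/
theorem ribbon (k m : ℕ) (c : ℕ → ℤ) (D I : Finset ((Fin k)ᵒᵈ × Fin m))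
    (hD : IsLowerSet (D : Set ((Fin k)ᵒᵈ × Fin m)))
    (hI : IsLowerSet (I : Set ((Fin k)ᵒᵈ × Fin m))) (hDI : D ⊆ I)
    (g : (Fin k)ᵒᵈ × Fin m → ℤ)
    (hg : ∀ x, g x = c ((OrderDual.ofDual x.1 : Fin k) + (x.2 : ℕ)))
    (hJ : ∀ J : Finset ((Fin k)ᵒᵈ × Fin m), IsLowerSet (J : Set ((Fin k)ᵒᵈ × Fin m)) →
      D ⊂ J → J ⊂ I → ∑ x ∈ J, g x < ∑ x ∈ D, g x ∧ ∑ x ∈ J, g x < ∑ x ∈ I, g x) :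
    (I \ D).card ≤ k + m - 1 := by
  classical
  let row : (Fin k)ᵒᵈ × Fin m → ℕ := fun x => ((OrderDual.ofDual x.1 : Fin k) : ℕ)
  let col : (Fin k)ᵒᵈ × Fin m → ℕ := fun x => (x.2 : ℕ)
  have le_iff : ∀ x y, x ≤ y ↔ row y ≤ row x ∧ col x ≤ col y := fun x y => Iff.rfl
  have ext' : ∀ x y, row x = row y → col x = col y → x = y := by
    intro x y h1 h2
    exact Prod.ext (Fin.ext h1) (Fin.ext h2)
  have hrow : ∀ x, row x < k := fun x => (OrderDual.ofDual x.1 : Fin k).2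
  have hcol : ∀ x, col x < m := fun x => x.2.2
  have mk : ∀ i p, i < k → p < m → ∃ x, row x = i ∧ col x = p :=
    fun i p hi hp => ⟨(OrderDual.toDual ⟨i, hi⟩, ⟨p, hp⟩), rfl, rfl⟩
  let Rel : (Fin k)ᵒᵈ × Fin m → (Fin k)ᵒᵈ × Fin m → Prop :=
    fun x y => row y = row x + 1 ∧ col y + 1 = col x
  have key : ¬ ∃ x ∈ I, ∃ y ∈ I \ D, Rel x y := by
    rintro ⟨x0, hx0, y0, hy0, h0⟩
    -- cells whose shift is in the complement of D
    let A := I.filter (fun x => ∃ y ∈ I \ D, Rel x y)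
    let B := (I \ D).filter (fun y => ∃ x ∈ I, Rel x y)
    have hAB : ∑ x ∈ A, g x = ∑ y ∈ B, g y := by
      have hA : ∀ x ∈ A, ∃ y, y ∈ I \ D ∧ Rel x y := fun x hx => by
        obtain ⟨-, y, h1, h2⟩ := Finset.mem_filter.1 hx
        exact ⟨y, h1, h2⟩
      choose f hf1 hf2 using hA
      refine Finset.sum_bij f ?_ ?_ ?_ ?_
      · intro x hx
        exact Finset.mem_filter.2 ⟨hf1 x hx, x, (Finset.mem_filter.1 hx).1, hf2 x hx⟩
      · intro x hx y hy hxy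
        have h1 := hf2 x hx
        have h2 := hf2 y hy
        rw [hxy] at h1
        refine ext' _ _ ?_ ?_
        · have a := h1.1; have b := h2.1; omega
        · have a := h1.2; have b := h2.2; omega
      · intro y hy
        obtain ⟨hy1, x, hx, h⟩ := Finset.mem_filter.1 hy
        have hxA : x ∈ A := Finset.mem_filter.2 ⟨hx, y, hy1, h⟩
        refine ⟨x, hxA, ?_⟩
        have h1 := hf2 x hxA
        refine ext' _ _ ?_ ?_
        · have a := h1.1; have b := h.1; omega
        · have a := h1.2; have b := h.2; omega
      · intro x hx
        have h1 := hf2 x hx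
        rw [hg, hg]
        congr 1
        have a := h1.1; have b := h1.2
        simp only [row, col] at a b
        omega
    have hAI : A ⊆ I := Finset.filter_subset _ _
    have hBI : B ⊆ I \ D := Finset.filter_subset _ _
    have hAD : ∀ x ∈ A, x ∉ D := by
      intro x hx hxD
      obtain ⟨-, y, hy, h⟩ := Finset.mem_filter.1 hx
      have : y ≤ x := (le_iff _ _).2 ⟨by have := h.1; omega, by have := h.2; omega⟩
      exact (Finset.mem_sdiff.1 hy).2 (hD this hxD)
    let U := I \ A
    let W := D ∪ B
    have hU : IsLowerSet (U : Set ((Fin k)ᵒᵈ × Fin m)) := by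
      intro x y hxy hx
      have hx' := Finset.mem_sdiff.1 (Finset.mem_coe.1 hx)
      refine Finset.mem_coe.2 (Finset.mem_sdiff.2 ⟨hI hxy hx'.1, fun hy => hx'.2 ?_⟩)
      obtain ⟨hyI, z, hz, h⟩ := Finset.mem_filter.1 hy
      have h1 := (le_iff _ _).1 hxy
      have h2 := hrow z; have h3 := hcol x
      have h4 := h.1; have h5 := h.2
      obtain ⟨w, hw1, hw2⟩ := mk (row x + 1) (col x - 1) (by omega) (by omega)
      have hzw : z ≤ w := (le_iff _ _).2 ⟨by omega, by omega⟩
      have hwx : w ≤ x := (le_iff _ _).2 ⟨by omega, by omega⟩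
      refine Finset.mem_filter.2 ⟨hx'.1, w, Finset.mem_sdiff.2 ⟨hI hwx hx'.1, fun hwD => ?_⟩,
        by omega, by omega⟩
      exact (Finset.mem_sdiff.1 hz).2 (hD hzw hwD)
    have hW : IsLowerSet (W : Set ((Fin k)ᵒᵈ × Fin m)) := by
      intro x y hxy hx
      by_cases hyD : y ∈ D
      · exact Finset.mem_coe.2 (Finset.mem_union_left _ hyD)
      rcases Finset.mem_union.1 (Finset.mem_coe.1 hx) with h | h
      · exact absurd (hD hxy h) hyD
      obtain ⟨hx1, z, hz, h⟩ := Finset.mem_filter.1 h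
      have h1 := (le_iff _ _).1 hxy
      have h2 := hrow y; have h3 := hcol z
      have h4 := h.1; have h5 := h.2
      obtain ⟨w, hw1, hw2⟩ := mk (row y - 1) (col y + 1) (by omega) (by omega)
      have hwz : w ≤ z := (le_iff _ _).2 ⟨by omega, by omega⟩
      refine Finset.mem_coe.2 (Finset.mem_union_right _ (Finset.mem_filter.2
        ⟨Finset.mem_sdiff.2 ⟨hI hxy (Finset.mem_sdiff.1 hx1).1, hyD⟩, w, hI hwz hz, by omega, by omega⟩))
    have hne : (I \ D).Nonempty := ⟨y0, hy0⟩
    obtain ⟨a, ha⟩ := Finset.exists_minimal hne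
    obtain ⟨b, hb⟩ := Finset.exists_maximal hne
    have haU : a ∈ U := by
      refine Finset.mem_sdiff.2 ⟨(Finset.mem_sdiff.1 ha.1).1, fun h => ?_⟩
      obtain ⟨-, y, hy, h⟩ := Finset.mem_filter.1 h
      have hya : y ≤ a := (le_iff _ _).2 ⟨by have := h.1; omega, by have := h.2; omega⟩
      have := (le_iff _ _).1 (ha.2 hy hya)
      have := h.1
      omega
    have hbW : b ∉ W := by
      intro h
      rcases Finset.mem_union.1 h with h | h
      · exact (Finset.mem_sdiff.1 hb.1).2 h
      obtain ⟨-, x, hx, h⟩ := Finset.mem_filter.1 h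
      have hbx : b ≤ x := (le_iff _ _).2 ⟨by have := h.1; omega, by have := h.2; omega⟩
      have hxD : x ∉ D := fun hx => (Finset.mem_sdiff.1 hb.1).2 (hD hbx hx)
      have := (le_iff _ _).1 (hb.2 (Finset.mem_sdiff.2 ⟨hx, hxD⟩) hbx)
      have := h.1
      omega
    have hx0A : x0 ∈ A := Finset.mem_filter.2 ⟨hx0, y0, hy0, h0⟩
    have hy0B : y0 ∈ B := Finset.mem_filter.2 ⟨hy0, x0, hx0, h0⟩
    have c1 := hJ U hU
      (Finset.ssubset_iff_subset_ne.2 ⟨fun z hz => Finset.mem_sdiff.2 ⟨hDI hz, fun h => hAD z h hz⟩,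
        fun h => (Finset.mem_sdiff.1 ha.1).2 (h ▸ haU)⟩)
      (Finset.ssubset_iff_subset_ne.2 ⟨Finset.sdiff_subset, fun h =>
        (Finset.mem_sdiff.1 (h.symm ▸ hx0 : x0 ∈ U)).2 hx0A⟩)
    have c2 := hJ W hW
      (Finset.ssubset_iff_subset_ne.2 ⟨Finset.subset_union_left,
        fun h => (Finset.mem_sdiff.1 hy0).2 (by rw [h]; exact Finset.mem_union_right _ hy0B)⟩)
      (Finset.ssubset_iff_subset_ne.2 ⟨Finset.union_subset hDI (hBI.trans Finset.sdiff_subset),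
        fun h => hbW (by rw [h]; exact (Finset.mem_sdiff.1 hb.1).1)⟩)
    have d1 : ∑ x ∈ U, g x = ∑ x ∈ I, g x - ∑ x ∈ A, g x := Finset.sum_sdiff_eq_sub hAI
    have d2 : ∑ x ∈ W, g x = ∑ x ∈ D, g x + ∑ x ∈ B, g x :=
      Finset.sum_union (Finset.disjoint_left.2 fun z hz hz' => (Finset.mem_sdiff.1 (hBI hz')).2 hz)
    have := c1.1; have := c2.2
    linarith
  have hmaps : ∀ x ∈ I \ D, row x + col x ∈ Finset.range (k + m - 1) := by
    intro x _
    have := hrow x; have := hcol x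
    simp only [Finset.mem_range]; omega
  have hlt : ∀ x ∈ I \ D, ∀ y ∈ I \ D, row x + col x = row y + col y → ¬ row x < row y := by
    intro x hx y hy h hlt
    have := hrow y; have := hcol x
    obtain ⟨w, hw1, hw2⟩ := mk (row x + 1) (col x - 1) (by omega) (by omega)
    have hyw : y ≤ w := (le_iff _ _).2 ⟨by omega, by omega⟩
    have hwx : w ≤ x := (le_iff _ _).2 ⟨by omega, by omega⟩
    exact key ⟨x, (Finset.mem_sdiff.1 hx).1, w, Finset.mem_sdiff.2
      ⟨hI hwx (Finset.mem_sdiff.1 hx).1, fun h => (Finset.mem_sdiff.1 hy).2 (hD hyw h)⟩,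
      by omega, by omega⟩
  calc (I \ D).card ≤ (Finset.range (k + m - 1)).card := by
        refine Finset.card_le_card_of_injOn (fun x => row x + col x) (fun x hx => hmaps x hx) ?_
        intro x hx y hy h
        have h1 := hlt x hx y hy h
        have h2 := hlt y hy x hx h.symm
        simp only at h
        exact ext' _ _ (by omega) (by omega)
    _ = k + m - 1 := Finset.card_range _

end PlacticId

namespace PlacticId

/-- 1 if the letter `x` occurs in the state `S`, else 0 -/
def hit {k : ℕ} (x : ℕ) (S : Fin k → ℕ) : ℕ := if ∃ i, S i = x then 1 else 0

theorem hit_le_one {k : ℕ} (x : ℕ) (S : Fin k → ℕ) : hit x S ≤ 1 := by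
  unfold hit; split_ifs <;> omega

theorem hit_of {k : ℕ} {x : ℕ} {S : Fin k → ℕ} (i : Fin k) (h : S i = x) : hit x S = 1 := by
  unfold hit; rw [if_pos ⟨i, h⟩]

theorem hit_cases {k : ℕ} (x : ℕ) (S : Fin k → ℕ) :
    (hit x S = 0 ∧ ∀ i, S i ≠ x) ∨ (hit x S = 1 ∧ ∃ i, S i = x) := by
  unfold hit
  split_ifs with h
  · exact Or.inr ⟨rfl, h⟩
  · exact Or.inl ⟨rfl, fun i hi => h ⟨i, hi⟩⟩

theorem hit_mono {k : ℕ} {x : ℕ} {S T : Fin k → ℕ} (h : ∀ i, S i = x → ∃ j, T j = x) :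
    hit x S ≤ hit x T := by
  rcases hit_cases x S with h1 | ⟨h1, i, hi⟩
  · omega
  · obtain ⟨j, hj⟩ := h i hi
    rw [h1, hit_of j hj]

theorem gap {k : ℕ} {S : Fin k → ℕ} (hS : StrictMono S) {i l : Fin k} (h : i ≤ l) :
    S i + (l - i : ℕ) ≤ S l := by
  obtain ⟨l, hl⟩ := l
  induction l with
  | zero =>
    have : i = ⟨0, hl⟩ := Fin.ext (by have : (i : ℕ) ≤ 0 := h; simp; omega)
    subst this; simp
  | succ l ih =>
    by_cases hi : i = ⟨l + 1, hl⟩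
    · subst hi; simp
    · have hil : (i : ℕ) ≤ l := by
        have h1 : (i : ℕ) ≤ l + 1 := h
        have h2 : (i : ℕ) ≠ l + 1 := fun h => hi (Fin.ext h)
        omega
      have h1 := ih (by omega) (show i ≤ ⟨l, by omega⟩ from hil)
      have h2 : S ⟨l, by omega⟩ < S ⟨l + 1, hl⟩ := hS (by simp [Fin.lt_def])
      simp only at h1 ⊢
      omega

theorem le_state {k : ℕ} {S : Fin k → ℕ} (hS : StrictMono S) (i : Fin k) : (i : ℕ) ≤ S i := by
  have h0 : 0 < k := by have := i.2; omega
  have := gap hS (i := ⟨0, h0⟩) (l := i) (by simp [Fin.le_def])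
  simp at this
  omega

theorem strict_update {k : ℕ} {S : Fin k → ℕ} (hS : StrictMono S) (l : Fin k) (y : ℕ)
    (h1 : ∀ p, p < l → S p < y) (h2 : ∀ p, l < p → y < S p) :
    StrictMono (Function.update S l y) := by
  intro p r hpr
  simp only [Function.update_apply]
  split_ifs with h h' h'
  · subst h; subst h'; exact absurd hpr (lt_irrefl _)
  · subst h; exact h2 _ hpr
  · subst h'; exact h1 _ hpr
  · exact hS hpr

theorem ple {k : ℕ} {S T : Fin k → ℕ} (h : S ≤ T) (i : Fin k) : S i ≤ T i := h i

/-- strictly increasing three-chains -/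
def Ch {k : ℕ} (A S1 S2 S3 B : Fin k → ℕ) : Prop :=
  StrictMono S1 ∧ StrictMono S2 ∧ StrictMono S3 ∧ A ≤ S1 ∧ S1 ≤ S2 ∧ S2 ≤ S3 ∧ S3 ≤ B

/-- up-push -/
def upush {k : ℕ} (S3 : Fin k → ℕ) (i : Fin k) (S : Fin k → ℕ) : Fin k → ℕ :=
  fun l => if l ≤ i then S3 l else max (S l) (S3 i + ((l : ℕ) - i))

theorem upush_strict {k : ℕ} {S3 S : Fin k → ℕ} (h3 : StrictMono S3) (hS : StrictMono S)
    (i : Fin k) : StrictMono (upush S3 i S) := by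
  intro p r hpr
  have hpr' : (p : ℕ) < r := hpr
  simp only [upush]
  split_ifs with h h' h'
  · exact h3 hpr
  · have := h3.monotone h
    have h4 : (i : ℕ) < r := not_le.1 h'
    exact lt_max_of_lt_right (by omega)
  · exact absurd (hpr.le.trans h') h
  · have := hS hpr
    have h4 : (i : ℕ) < p := not_le.1 h
    refine max_lt (lt_max_of_lt_left this) (lt_max_of_lt_right (by omega))

theorem le_upush {k : ℕ} {S3 S : Fin k → ℕ} (h : S ≤ S3) (i : Fin k) : S ≤ upush S3 i S := by
  intro l
  simp only [upush]
  split_ifs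
  · exact h l
  · exact le_max_left _ _

theorem upush_le {k : ℕ} {S3 S : Fin k → ℕ} (h3 : StrictMono S3) (h : S ≤ S3) (i : Fin k) :
    upush S3 i S ≤ S3 := by
  intro l
  simp only [upush]
  split_ifs with hl
  · exact le_rfl
  · exact max_le (h l) (gap h3 (not_le.1 hl).le)

theorem upush_mono {k : ℕ} (S3 : Fin k → ℕ) {S T : Fin k → ℕ} (h : S ≤ T) (i : Fin k) :
    upush S3 i S ≤ upush S3 i T := by
  intro l
  simp only [upush]
  split_ifs with hl
  · exact le_rfl
  · exact max_le_max (h l) le_rfl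

theorem upush_hit {k : ℕ} {S3 S : Fin k → ℕ} (h3 : StrictMono S3) (hS : StrictMono S) (h : S ≤ S3)
    (i : Fin k) (x : ℕ) (hx : S3 i < x) : hit x S ≤ hit x (upush S3 i S) := by
  refine hit_mono fun l hl => ?_
  have hil : i < l := by
    by_contra hc
    have := h3.monotone (not_lt.1 hc)
    have := ple h l
    omega
  have hil' : (i : ℕ) < l := hil
  by_cases hc : S3 i + ((l : ℕ) - i) ≤ x
  · refine ⟨l, ?_⟩
    simp only [upush, if_neg (not_le.2 hil)]
    omega
  · have hlt : (i : ℕ) + (x - S3 i) < l := by omega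
    refine ⟨⟨i + (x - S3 i), by omega⟩, ?_⟩
    have h1 : S ⟨i + (x - S3 i), by omega⟩ < S l := hS (by simp only [Fin.lt_def]; exact hlt)
    have h2 : ¬ (⟨i + (x - S3 i), by omega⟩ : Fin k) ≤ i := by simp only [Fin.le_def]; omega
    simp only [upush, if_neg h2]
    omega

/-- down-push -/
def dpush {k : ℕ} (S1 : Fin k → ℕ) (i : Fin k) (S : Fin k → ℕ) : Fin k → ℕ :=
  fun l => if i ≤ l then S1 l else min (S l) (S1 i - ((i : ℕ) - l))

theorem dpush_strict {k : ℕ} {S1 S : Fin k → ℕ} (h1 : StrictMono S1) (hS : StrictMono S)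
    (i : Fin k) : StrictMono (dpush S1 i S) := by
  intro p r hpr
  have hpr' : (p : ℕ) < r := hpr
  have hi := le_state h1 i
  simp only [dpush]
  split_ifs with h h' h'
  · exact h1 hpr
  · exact absurd (h.trans hpr.le) h'
  · have := h1.monotone h'
    have h4 : (p : ℕ) < i := not_le.1 h
    exact min_lt_of_right_lt (by omega)
  · have := hS hpr
    have h4 : (r : ℕ) < i := not_le.1 h'
    refine lt_min (min_lt_of_left_lt this) (min_lt_of_right_lt (by omega))

theorem dpush_le {k : ℕ} {S1 S : Fin k → ℕ} (h : S1 ≤ S) (i : Fin k) : dpush S1 i S ≤ S := by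
  intro l
  simp only [dpush]
  split_ifs
  · exact h l
  · exact min_le_left _ _

theorem le_dpush {k : ℕ} {S1 S : Fin k → ℕ} (h1 : StrictMono S1) (h : S1 ≤ S) (i : Fin k) :
    S1 ≤ dpush S1 i S := by
  intro l
  simp only [dpush]
  split_ifs with hl
  · exact le_rfl
  · have := gap h1 (not_le.1 hl).le
    exact le_min (h l) (by omega)

theorem dpush_mono {k : ℕ} (S1 : Fin k → ℕ) {S T : Fin k → ℕ} (h : S ≤ T) (i : Fin k) :
    dpush S1 i S ≤ dpush S1 i T := by
  intro l
  simp only [dpush]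
  split_ifs with hl
  · exact le_rfl
  · exact min_le_min (h l) le_rfl

theorem dpush_hit {k : ℕ} {S1 S : Fin k → ℕ} (h1 : StrictMono S1) (hS : StrictMono S) (h : S1 ≤ S)
    (i : Fin k) (x : ℕ) (hx : x < S1 i) : hit x S ≤ hit x (dpush S1 i S) := by
  refine hit_mono fun l hl => ?_
  have hi := le_state h1 i
  have hil : l < i := by
    by_contra hc
    have := h1.monotone (not_lt.1 hc)
    have := ple h l
    omega
  have hil' : (l : ℕ) < i := hil
  have hi2 := i.2
  by_cases hc : x ≤ S1 i - ((i : ℕ) - l)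
  · refine ⟨l, ?_⟩
    simp only [dpush, if_neg (not_le.2 hil)]
    omega
  · have hlt : (l : ℕ) < i - (S1 i - x) := by omega
    refine ⟨⟨i - (S1 i - x), by omega⟩, ?_⟩
    have h1 : S l < S ⟨i - (S1 i - x), by omega⟩ := hS (by simp only [Fin.lt_def]; exact hlt)
    have h2 : ¬ i ≤ (⟨i - (S1 i - x), by omega⟩ : Fin k) := by simp only [Fin.le_def]; omega
    simp only [dpush, if_neg h2]
    omega

theorem K1 {k : ℕ} {A B S1 S2 S3 : Fin k → ℕ} (hC : Ch A S1 S2 S3 B) {a b c : ℕ}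
    (hab : a < b) (hbc : b ≤ c) : ∃ T1 T2 T3, Ch A T1 T2 T3 B ∧
      hit b S1 + hit c S2 + hit a S3 ≤ hit b T1 + hit a T2 + hit c T3 := by
  obtain ⟨s1, s2, s3, hA, h12, h23, hB⟩ := hC
  rcases hit_cases a S3 with ⟨h0, -⟩ | ⟨h0, i, hi⟩
  · exact ⟨S1, S1, S2, ⟨s1, s1, s2, hA, le_rfl, h12, h23.trans hB⟩, by omega⟩
  · have h13 := h12.trans h23
    refine ⟨S1, upush S3 i S1, upush S3 i S2, ⟨s1, upush_strict s3 s1 i, upush_strict s3 s2 i, hA,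
      le_upush h13 i, upush_mono S3 h12 i, (upush_le s3 h23 i).trans hB⟩, ?_⟩
    have e1 := upush_hit s3 s2 h23 i c (by omega)
    have e2 : hit a (upush S3 i S1) = 1 := hit_of i (by simp [upush, hi])
    omega

theorem K3 {k : ℕ} {A B S1 S2 S3 : Fin k → ℕ} (hC : Ch A S1 S2 S3 B) {a b c : ℕ}
    (hab : a ≤ b) (hbc : b < c) : ∃ T1 T2 T3, Ch A T1 T2 T3 B ∧
      hit c S1 + hit a S2 + hit b S3 ≤ hit a T1 + hit c T2 + hit b T3 := by
  obtain ⟨s1, s2, s3, hA, h12, h23, hB⟩ := hC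
  rcases hit_cases c S1 with ⟨h0, -⟩ | ⟨h0, i, hi⟩
  · exact ⟨S2, S2, S3, ⟨s2, s2, s3, hA.trans h12, le_rfl, h23, hB⟩, by omega⟩
  · have h13 := h12.trans h23
    refine ⟨dpush S1 i S2, dpush S1 i S3, S3, ⟨dpush_strict s1 s2 i, dpush_strict s1 s3 i, s3,
      hA.trans (le_dpush s1 h12 i), dpush_mono S1 h23 i, dpush_le h13 i, hB⟩, ?_⟩
    have e1 := dpush_hit s1 s2 h12 i a (by omega)
    have e2 : hit c (dpush S1 i S3) = 1 := hit_of i (by simp [dpush, hi])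
    omega

theorem K2 {k : ℕ} {A B S1 S2 S3 : Fin k → ℕ} (hC : Ch A S1 S2 S3 B) {a b c : ℕ}
    (hab : a < b) (hbc : b ≤ c) : ∃ T1 T2 T3, Ch A T1 T2 T3 B ∧
      hit b S1 + hit a S2 + hit c S3 ≤ hit b T1 + hit c T2 + hit a T3 := by
  obtain ⟨s1, s2, s3, hA, h12, h23, hB⟩ := hC
  rcases hit_cases c S3 with ⟨h0, -⟩ | ⟨h0, j, hj⟩
  · exact ⟨S1, S2, S2, ⟨s1, s2, s2, hA, h12, le_rfl, h23.trans hB⟩, by omega⟩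
  rcases hit_cases a S2 with ⟨h0', -⟩ | ⟨h0', i, hi⟩
  · exact ⟨S1, S3, S3, ⟨s1, s3, s3, hA, h12.trans h23, le_rfl, hB⟩, by omega⟩
  have h13 := h12.trans h23
  obtain ⟨l, hl, hmax⟩ := Finset.exists_max_image (Finset.univ.filter fun l => S1 l ≤ c) id
    ⟨j, by simpa using hj ▸ h13 j⟩
  simp only [Finset.mem_filter, Finset.mem_univ, true_and, id] at hl hmax
  have hjl : j ≤ l := hmax j (hj ▸ h13 j)
  have hil : i ≤ l := hmax i (by have := ple h12 i; omega)
  have hgt : ∀ p, l < p → c < S1 p := fun p hp => by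
    by_contra hc
    exact absurd (hmax p (not_lt.1 hc)) (not_le.2 hp)
  have hlt : ∀ p, p < l → S1 p < c := fun p hp => lt_of_lt_of_le (s1 hp) hl
  have t2 := strict_update s1 l c hlt hgt
  have hT2 : Function.update S1 l c ≤ S3 := by
    intro p
    simp only [Function.update_apply]
    split_ifs with h
    · subst h; rw [← hj]; exact s3.monotone hjl
    · exact h13 p
  have hT1 : S1 ≤ Function.update S1 l c := by
    intro p
    simp only [Function.update_apply]
    split_ifs with h
    · subst h; exact hl
    · exact le_rfl
  have hc : hit c (Function.update S1 l c) = 1 := hit_of l (by simp)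
  rcases hil.lt_or_eq with hil | hil
  · refine ⟨S1, Function.update S1 l c, fun p => max (Function.update S1 l c p) (S2 p),
      ⟨s1, t2, fun p r h => max_lt_max (t2 h) (s2 h), hA, hT1, fun p => le_max_left _ _,
        fun p => (max_le (hT2 p) (h23 p)).trans (hB p)⟩, ?_⟩
    have : hit a (fun p => max (Function.update S1 l c p) (S2 p)) = 1 := hit_of i (by
      have := ple h12 i
      simp only [Function.update_of_ne hil.ne]
      omega)
    omega
  · subst hil
    have hb : hit b S1 = 0 := by
      rcases hit_cases b S1 with h | ⟨-, p, hp⟩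
      · exact h.1
      · have h1 : p ≤ i := hmax p (by omega)
        have h2 := s1.monotone h1
        have h3 := ple h12 i
        omega
    have h3 := ple h12 i
    refine ⟨Function.update S1 i b, Function.update S1 i c, Function.update S1 i c,
      ⟨strict_update s1 i b (fun p hp => ?_) (fun p hp => ?_), t2, t2, ?_, ?_, le_rfl,
        hT2.trans hB⟩, ?_⟩
    · have := s1 hp; omega
    · have := hgt p hp; omega
    · intro p
      simp only [Function.update_apply]
      have := ple hA p
      split_ifs with h
      · subst h; omega
      · exact this
    · intro p
      simp only [Function.update_apply]
      split_ifs with h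
      · exact hbc
      · exact le_rfl
    · have : hit b (Function.update S1 i b) = 1 := hit_of i (by simp)
      omega

theorem K4 {k : ℕ} {A B S1 S2 S3 : Fin k → ℕ} (hC : Ch A S1 S2 S3 B) {a b c : ℕ}
    (hab : a ≤ b) (hbc : b < c) : ∃ T1 T2 T3, Ch A T1 T2 T3 B ∧
      hit a S1 + hit c S2 + hit b S3 ≤ hit c T1 + hit a T2 + hit b T3 := by
  obtain ⟨s1, s2, s3, hA, h12, h23, hB⟩ := hC
  rcases hit_cases a S1 with ⟨h0, -⟩ | ⟨h0, j, hj⟩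
  · exact ⟨S2, S2, S3, ⟨s2, s2, s3, hA.trans h12, le_rfl, h23, hB⟩, by omega⟩
  rcases hit_cases c S2 with ⟨h0', -⟩ | ⟨h0', i, hi⟩
  · exact ⟨S1, S1, S3, ⟨s1, s1, s3, hA, le_rfl, h12.trans h23, hB⟩, by omega⟩
  have h13 := h12.trans h23
  obtain ⟨l, hl, hmin⟩ := Finset.exists_min_image (Finset.univ.filter fun l => a ≤ S3 l) id
    ⟨j, by simpa using hj ▸ h13 j⟩
  simp only [Finset.mem_filter, Finset.mem_univ, true_and, id] at hl hmin
  have hjl : l ≤ j := hmin j (hj ▸ h13 j)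
  have hil : l ≤ i := hmin i (by have := ple h23 i; omega)
  have hlt : ∀ p, p < l → S3 p < a := fun p hp => by
    by_contra hc
    exact absurd (hmin p (not_lt.1 hc)) (not_le.2 hp)
  have hgt : ∀ p, l < p → a < S3 p := fun p hp => lt_of_le_of_lt hl (s3 hp)
  have t2 := strict_update s3 l a hlt hgt
  have hT2 : S1 ≤ Function.update S3 l a := by
    intro p
    simp only [Function.update_apply]
    split_ifs with h
    · subst h; rw [← hj]; exact s1.monotone hjl
    · exact h13 p
  have hT3 : Function.update S3 l a ≤ S3 := by
    intro p
    simp only [Function.update_apply]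
    split_ifs with h
    · subst h; exact hl
    · exact le_rfl
  have hc : hit a (Function.update S3 l a) = 1 := hit_of l (by simp)
  rcases hil.lt_or_eq with hil | hil
  · refine ⟨fun p => min (Function.update S3 l a p) (S2 p), Function.update S3 l a, S3,
      ⟨fun p r h => min_lt_min (t2 h) (s2 h), t2, s3,
        fun p => (hA p).trans (le_min (hT2 p) (h12 p)), fun p => min_le_left _ _, hT3, hB⟩, ?_⟩
    have : hit c (fun p => min (Function.update S3 l a p) (S2 p)) = 1 := hit_of i (by
      have := ple h23 i
      simp only [Function.update_of_ne hil.ne']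
      omega)
    omega
  · subst hil
    have hb : hit b S3 = 0 := by
      rcases hit_cases b S3 with h | ⟨-, p, hp⟩
      · exact h.1
      · have h1 : l ≤ p := hmin p (by omega)
        have h2 := s3.monotone h1
        have h3 := ple h23 l
        omega
    have h3 := ple h23 l
    refine ⟨Function.update S3 l a, Function.update S3 l a, Function.update S3 l b,
      ⟨t2, t2, strict_update s3 l b (fun p hp => ?_) (fun p hp => ?_), hA.trans hT2, le_rfl, ?_, ?_⟩,
        ?_⟩
    · have := hlt p hp; omega
    · have := s3 hp; omega
    · intro p
      simp only [Function.update_apply]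
      split_ifs with h
      · exact hab
      · exact le_rfl
    · intro p
      simp only [Function.update_apply]
      have := ple hB p
      split_ifs with h
      · subst h; omega
      · exact this
    · have : hit b (Function.update S3 l b) = 1 := hit_of l (by simp)
      omega

/-- weighted chains of states reading a word -/
def W {k : ℕ} : List ℕ → (Fin k → ℕ) → (Fin k → ℕ) → ℕ → Prop
  | [], P, Q, v => P ≤ Q ∧ v ≤ 0
  | x :: w, P, Q, v => ∃ S v', StrictMono S ∧ P ≤ S ∧ W w S Q v' ∧ v ≤ hit x S + v'

theorem W_mono {k : ℕ} : ∀ (w : List ℕ) {P P' Q : Fin k → ℕ} {v v' : ℕ}, P' ≤ P → v' ≤ v →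
    W w P Q v → W w P' Q v'
  | [], _, _, _, _, _, hP, hv, h => ⟨hP.trans h.1, hv.trans h.2⟩
  | _ :: _, _, _, _, _, _, hP, hv, ⟨S, u, h1, h2, h3, h4⟩ => ⟨S, u, h1, hP.trans h2, h3, hv.trans h4⟩

theorem W_append {k : ℕ} : ∀ (w1 w2 : List ℕ) (P Q : Fin k → ℕ) (v : ℕ),
    W (w1 ++ w2) P Q v ↔ ∃ R v1 v2, W w1 P R v1 ∧ W w2 R Q v2 ∧ v ≤ v1 + v2
  | [], w2, P, Q, v => by
    constructor
    · intro h
      exact ⟨P, 0, v, ⟨le_rfl, le_rfl⟩, h, by omega⟩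
    · rintro ⟨R, v1, v2, ⟨h1, h1'⟩, h2, h3⟩
      exact W_mono w2 h1 (by omega) h2
  | x :: w1, w2, P, Q, v => by
    constructor
    · rintro ⟨S, v', h1, h2, h3, h4⟩
      obtain ⟨R, v1, v2, a, b, c⟩ := (W_append w1 w2 S Q v').1 h3
      exact ⟨R, hit x S + v1, v2, ⟨S, v1, h1, h2, a, le_rfl⟩, b, by omega⟩
    · rintro ⟨R, v1, v2, ⟨S, v', h1, h2, h3, h4⟩, b, c⟩
      exact ⟨S, v' + v2, h1, h2, (W_append w1 w2 S Q _).2 ⟨R, v', v2, h3, b, le_rfl⟩, by omega⟩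

theorem W3 {k : ℕ} (x y z : ℕ) (P Q : Fin k → ℕ) (v : ℕ) :
    W [x, y, z] P Q v ↔ ∃ S1 S2 S3, Ch P S1 S2 S3 Q ∧ v ≤ hit x S1 + hit y S2 + hit z S3 := by
  constructor
  · rintro ⟨S1, v1, a1, b1, ⟨S2, v2, a2, b2, ⟨S3, v3, a3, b3, ⟨h, h'⟩, c3⟩, c2⟩, c1⟩
    exact ⟨S1, S2, S3, ⟨a1, a2, a3, b1, b2, b3, h⟩, by omega⟩
  · rintro ⟨S1, S2, S3, ⟨a1, a2, a3, b1, b2, b3, h⟩, hv⟩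
    exact ⟨S1, _, a1, b1, ⟨S2, _, a2, b2, ⟨S3, 0, a3, b3, ⟨h, le_rfl⟩, le_rfl⟩, le_rfl⟩, by omega⟩

theorem W_knuth1 {k : ℕ} {a b c : ℕ} (hab : a < b) (hbc : b ≤ c) (P Q : Fin k → ℕ) (v : ℕ) :
    W [b, c, a] P Q v ↔ W [b, a, c] P Q v := by
  rw [W3, W3]
  constructor
  · rintro ⟨S1, S2, S3, h, hv⟩
    obtain ⟨T1, T2, T3, h', hv'⟩ := K1 h hab hbc
    exact ⟨T1, T2, T3, h', hv.trans hv'⟩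
  · rintro ⟨S1, S2, S3, h, hv⟩
    obtain ⟨T1, T2, T3, h', hv'⟩ := K2 h hab hbc
    exact ⟨T1, T2, T3, h', hv.trans hv'⟩

theorem W_knuth2 {k : ℕ} {a b c : ℕ} (hab : a ≤ b) (hbc : b < c) (P Q : Fin k → ℕ) (v : ℕ) :
    W [c, a, b] P Q v ↔ W [a, c, b] P Q v := by
  rw [W3, W3]
  constructor
  · rintro ⟨S1, S2, S3, h, hv⟩
    obtain ⟨T1, T2, T3, h', hv'⟩ := K3 h hab hbc
    exact ⟨T1, T2, T3, h', hv.trans hv'⟩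
  · rintro ⟨S1, S2, S3, h, hv⟩
    obtain ⟨T1, T2, T3, h', hv'⟩ := K4 h hab hbc
    exact ⟨T1, T2, T3, h', hv.trans hv'⟩

end PlacticId

namespace PlacticId

section Insertion
variable {α : Type*} [LinearOrder α]

/-- bumping insertion into a column -/
def ins (x : α) : List α → List α × Option α
  | [] => ([x], none)
  | a :: s => if x ≤ a then (x :: s, some a) else (a :: (ins x s).1, (ins x s).2)

/-- insertion into a tableau given by its columns -/
def insT : α → List (List α) → List (List α)
  | x, [] => [[x]]
  | x, C :: T => (ins x C).1 :: (match (ins x C).2 with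
    | none => T
    | some y => insT y T)

/-- column reading word -/
def tw (T : List (List α)) : List α := (T.map List.reverse).flatten

/-- column dominance -/
def Dom : List α → List α → Prop
  | _, [] => True
  | [], _ :: _ => False
  | a :: s, b :: r => a ≤ b ∧ Dom s r

/-- semistandard tableaux given by columns -/
def Tab : List (List α) → Prop
  | [] => True
  | C :: T => C.Pairwise (· < ·) ∧ C ≠ [] ∧ Dom C (T.headD []) ∧ Tab T

theorem Dom_nil (s : List α) : Dom s [] := by cases s <;> trivial

theorem ins_mem (x : α) : ∀ (s : List α) (z : α), z ∈ (ins x s).1 → z = x ∨ z ∈ s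
  | [], z, h => by simpa [ins] using h
  | a :: s, z, h => by
    have ih := ins_mem x s z
    simp only [ins] at h
    split_ifs at h
    · simp only [List.mem_cons] at h ⊢; tauto
    · simp only [List.mem_cons] at h ⊢; tauto

theorem ins_out_mem (x : α) : ∀ (s : List α) (z : α), (ins x s).2 = some z → z ∈ s
  | [], z, h => by simp [ins] at h
  | a :: s, z, h => by
    have ih := ins_out_mem x s z
    simp only [ins] at h
    split_ifs at h
    · simp at h; simp [h]
    · exact List.mem_cons_of_mem _ (ih h)

theorem ins_ne_nil (x : α) (s : List α) : (ins x s).1 ≠ [] := by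
  cases s with
  | nil => simp [ins]
  | cons a s => simp only [ins]; split_ifs <;> simp

theorem ins_sorted (x : α) : ∀ s : List α, s.Pairwise (· < ·) → (ins x s).1.Pairwise (· < ·)
  | [], _ => by simp [ins]
  | a :: s, h => by
    rw [List.pairwise_cons] at h
    simp only [ins]
    split_ifs with hx
    · exact List.pairwise_cons.2 ⟨fun z hz => lt_of_le_of_lt hx (h.1 z hz), h.2⟩
    · refine List.pairwise_cons.2 ⟨fun z hz => ?_, ins_sorted x s h.2⟩
      rcases ins_mem x s z hz with rfl | hz
      · exact not_le.1 hx
      · exact h.1 z hz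

theorem ins_head (x : α) (s : List α) (hs : s.Pairwise (· < ·)) (y : α)
    (h : (ins x s).2 = some y) : ∃ b t, (ins x s).1 = b :: t ∧ b ≤ y := by
  cases s with
  | nil => simp [ins] at h
  | cons a s =>
    rw [List.pairwise_cons] at hs
    simp only [ins] at h ⊢
    split_ifs with hx
    · rw [if_pos hx] at h
      simp only [Option.some.injEq] at h
      exact ⟨x, s, rfl, h ▸ hx⟩
    · rw [if_neg hx] at h
      exact ⟨a, _, rfl, (hs.1 y (ins_out_mem x s y h)).le⟩

theorem Dom_ins (x : α) : ∀ s r : List α, Dom s r → Dom (ins x s).1 r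
  | s, [], _ => Dom_nil _
  | [], _ :: _, h => h.elim
  | a :: s, b :: r, h => by
    simp only [ins]
    split_ifs with hx
    · exact ⟨hx.trans h.1, h.2⟩
    · exact ⟨h.1, Dom_ins x s r h.2⟩

theorem Dom_bump (x : α) : ∀ s r : List α, s.Pairwise (· < ·) → Dom s r → ∀ y,
    (ins x s).2 = some y → Dom (ins x s).1 (ins y r).1
  | [], r, _, _, y, hy => by simp [ins] at hy
  | a :: s, [], hs, h, y, hy => by
    rw [List.pairwise_cons] at hs
    simp only [ins] at hy ⊢
    split_ifs with hx
    · rw [if_pos hx] at hy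
      simp only [Option.some.injEq] at hy
      exact ⟨hy ▸ hx, Dom_nil _⟩
    · rw [if_neg hx] at hy
      exact ⟨(hs.1 y (ins_out_mem x s y hy)).le, Dom_nil _⟩
  | a :: s, b :: r, hs, h, y, hy => by
    rw [List.pairwise_cons] at hs
    simp only [ins] at hy
    split_ifs at hy with hx
    · simp only [Option.some.injEq] at hy
      subst hy
      simp only [ins, if_pos hx, if_pos h.1]
      exact ⟨hx, h.2⟩
    · simp only [ins, if_neg hx]
      split_ifs with hyb
      · exact ⟨(hs.1 y (ins_out_mem x s y hy)).le, Dom_ins x s r h.2⟩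
      · exact ⟨h.1, Dom_bump x s r hs.2 h.2 y hy⟩

theorem insT_head (x : α) (T : List (List α)) : (insT x T).headD [] = (ins x (T.headD [])).1 := by
  cases T <;> simp [insT, ins]

theorem insT_tab : ∀ (x : α) (T : List (List α)), Tab T → Tab (insT x T)
  | x, [], _ => by simp [insT, Tab, Dom_nil]
  | x, C :: T, h => by
    obtain ⟨h1, h2, h3, h4⟩ := h
    simp only [insT]
    rcases hy : (ins x C).2 with _ | y
    · exact ⟨ins_sorted x C h1, ins_ne_nil x C, Dom_ins x C _ h3, h4⟩
    · refine ⟨ins_sorted x C h1, ins_ne_nil x C, ?_, insT_tab y T h4⟩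
      simp only [insT_head]
      exact Dom_bump x C _ h1 h3 y hy

variable {M : Type*} [Monoid M] (f : α → M)

theorem push_right (K2 : ∀ a b c : α, a ≤ b → b < c → f c * f a * f b = f a * f c * f b) (x : α) :
    ∀ (s : List α) (a : α), (a :: s).Pairwise (· < ·) → x ≤ a →
    f x * (s.reverse.map f).prod * f a = (s.reverse.map f).prod * f x * f a
  | [], a, _, _ => by simp
  | c :: s, a, h, hx => by
    have hac : a < c := (List.pairwise_cons.1 h).1 c (by simp)
    have ih := push_right K2 x s c (List.pairwise_cons.1 h).2 (hx.trans hac.le)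
    simp only [List.reverse_cons, List.map_append, List.prod_append, List.map_cons, List.map_nil,
      List.prod_singleton]
    have e := K2 x a c hx hac
    rw [← mul_assoc, ih]
    simp only [mul_assoc] at e ⊢
    rw [e]

theorem ins_prod (K1 : ∀ a b c : α, a < b → b ≤ c → f b * f c * f a = f b * f a * f c)
    (K2 : ∀ a b c : α, a ≤ b → b < c → f c * f a * f b = f a * f c * f b) (x : α) :
    ∀ s : List α, s.Pairwise (· < ·) → f x * (s.reverse.map f).prod =
      ((ins x s).1.reverse.map f).prod * ((ins x s).2.toList.map f).prod
  | [], _ => by simp [ins]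
  | a :: s, h => by
    have h' := List.pairwise_cons.1 h
    have ih := ins_prod K1 K2 x s h'.2
    simp only [ins]
    split_ifs with hx
    · have := push_right f K2 x s a h hx
      simpa [mul_assoc] using this
    · simp only [List.reverse_cons, List.map_append, List.prod_append, List.map_cons, List.map_nil,
        List.prod_singleton]
      rw [← mul_assoc, ih]
      rcases hy : (ins x s).2 with _ | y
      · simp
      · obtain ⟨b, t, hb, hby⟩ := ins_head x s h'.2 y hy
        have hab : a < b := by
          rcases ins_mem x s b (by simp [hb]) with rfl | hz
          · exact not_le.1 hx
          · exact h'.1 b hz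
        have e := K1 a b y hab hby
        rw [hb]
        simp only [List.reverse_cons, List.map_append, List.prod_append, List.map_cons, List.map_nil,
          List.prod_singleton, Option.toList_some, mul_assoc] at e ⊢
        rw [e]

theorem insT_prod (K1 : ∀ a b c : α, a < b → b ≤ c → f b * f c * f a = f b * f a * f c)
    (K2 : ∀ a b c : α, a ≤ b → b < c → f c * f a * f b = f a * f c * f b) :
    ∀ (x : α) (T : List (List α)), Tab T → f x * ((tw T).map f).prod = ((tw (insT x T)).map f).prod
  | x, [], _ => by simp [insT, tw]
  | x, C :: T, h => by
    obtain ⟨h1, h2, h3, h4⟩ := h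
    have e := ins_prod f K1 K2 x C h1
    have tc : ∀ (C : List α) T, ((tw (C :: T)).map f).prod =
      (C.reverse.map f).prod * ((tw T).map f).prod := fun C T => by simp [tw]
    simp only [insT, tc]
    rw [← mul_assoc, e]
    rcases hy : (ins x C).2 with _ | y
    · simp
    · simp only [Option.toList_some, List.map_cons, List.map_nil, List.prod_singleton]
      rw [mul_assoc, insT_prod K1 K2 y T h4]

theorem exists_tab (K1 : ∀ a b c : α, a < b → b ≤ c → f b * f c * f a = f b * f a * f c)
    (K2 : ∀ a b c : α, a ≤ b → b < c → f c * f a * f b = f a * f c * f b) :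
    ∀ w : List α, ∃ T, Tab T ∧ (w.map f).prod = ((tw T).map f).prod
  | [] => ⟨[], trivial, by simp [tw]⟩
  | x :: w => by
    obtain ⟨T, hT, h⟩ := exists_tab K1 K2 w
    refine ⟨insT x T, insT_tab x T hT, ?_⟩
    rw [← insT_prod f K1 K2 x T hT, ← h]
    simp

end Insertion

section Weights

/-- number of entries less than `j` -/
def cnt (C : List ℕ) (j : ℕ) : ℕ := C.countP (fun x => decide (x < j))

/-- the invariant -/
def FF (T : List (List ℕ)) (k j : ℕ) : ℕ := (T.map fun C => min k (cnt C j)).sum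

theorem W_le {k : ℕ} : ∀ (w : List ℕ) (P Q : Fin k → ℕ) (v : ℕ), W w P Q v → P ≤ Q
  | [], _, _, _, h => h.1
  | _ :: w, _, _, _, ⟨_, _, _, h2, h3, _⟩ => h2.trans (W_le w _ _ _ h3)

theorem W_cnt {k m : ℕ} : ∀ (w : List ℕ) (P Q : Fin k → ℕ) (v : ℕ), (∀ i, Q i ≤ m + i) →
    W w P Q v → v ≤ cnt w (k + m)
  | [], _, _, _, _, h => h.2.trans (Nat.zero_le _)
  | x :: w, _, Q, v, hQ, ⟨S, v', _, h2, h3, h4⟩ => by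
    have ih := W_cnt w _ _ _ hQ h3
    have hSQ := W_le w _ _ _ h3
    have : cnt (x :: w) (k + m) = cnt w (k + m) + (if x < k + m then 1 else 0) := by
      simp [cnt, List.countP_cons]
    rw [this]
    rcases hit_cases x S with ⟨h, -⟩ | ⟨h, i, hi⟩
    · omega
    · have a := ple hSQ i
      have b := hQ i
      have c := i.2
      rw [if_pos (by omega)]
      omega

theorem W_col {k : ℕ} : ∀ (w : List ℕ) (P Q : Fin k → ℕ) (v B : ℕ), w.Pairwise (· > ·) →
    (∀ x ∈ w, x < B) → W w P Q v → v ≤ (Finset.univ.filter fun i => P i < B).card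
  | [], _, _, _, _, _, _, h => h.2.trans (Nat.zero_le _)
  | x :: w, P, Q, v, B, hw, hB, ⟨S, v', _, h2, h3, h4⟩ => by
    rw [List.pairwise_cons] at hw
    have ih := W_col w S Q v' x hw.2 (fun y hy => hw.1 y hy) h3
    have hx := hB x (by simp)
    have sub : (Finset.univ.filter fun i => S i < x) ⊆ (Finset.univ.filter fun i => P i < B) := by
      intro i hi
      have := ple h2 i
      simp only [Finset.mem_filter, Finset.mem_univ, true_and] at hi ⊢
      omega
    rcases hit_cases x S with ⟨h, -⟩ | ⟨h, i, hi⟩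
    · have := Finset.card_le_card sub
      omega
    · have : insert i (Finset.univ.filter fun i => S i < x) ⊆
          (Finset.univ.filter fun i => P i < B) := by
        refine Finset.insert_subset ?_ sub
        have := ple h2 i
        simp only [Finset.mem_filter, Finset.mem_univ, true_and]
        omega
      have := Finset.card_le_card this
      rw [Finset.card_insert_of_notMem (by simp [hi])] at this
      omega

theorem FF_upper {k m : ℕ} : ∀ (T : List (List ℕ)) (P Q : Fin k → ℕ) (v : ℕ), Tab T →
    (∀ i, Q i ≤ m + i) → W (tw T) P Q v → v ≤ FF T k (k + m)
  | [], _, _, _, _, _, h => h.2.trans (Nat.zero_le _)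
  | C :: T, P, Q, v, hT, hQ, h => by
    have e : tw (C :: T) = C.reverse ++ tw T := by simp [tw]
    rw [e, W_append] at h
    obtain ⟨R, v1, v2, h1, h2, h3⟩ := h
    have ih := FF_upper T R Q v2 hT.2.2.2 hQ h2
    have hRQ := W_le _ _ _ _ h2
    have c1 := W_cnt (m := m) _ _ _ _ (fun i => (hRQ i).trans (hQ i)) h1
    obtain ⟨B, hB⟩ : ∃ B, ∀ x ∈ C.reverse, x < B :=
      ⟨C.reverse.sum + 1, fun x hx => Nat.lt_succ_of_le (List.le_sum_of_mem hx)⟩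
    have c2 := W_col _ _ _ _ B (by rw [List.pairwise_reverse]; exact hT.1) hB h1
    have c3 := c2.trans (Finset.card_le_univ _)
    rw [Fintype.card_fin] at c3
    have c4 : cnt C.reverse (k + m) = cnt C (k + m) := by simp [cnt]
    have : FF (C :: T) k (k + m) = min k (cnt C (k + m)) + FF T k (k + m) := by simp [FF]
    omega

/-- constant state for a column -/
def st {k : ℕ} (m : ℕ) (C : List ℕ) : Fin k → ℕ := fun i => min (C.getD i (m + i)) (m + i)

theorem sorted_getElem {C : List ℕ} (h : C.Pairwise (· < ·)) {i j : ℕ} (hj : j < C.length)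
    (hij : i < j) : C[i] < C[j] := List.pairwise_iff_getElem.1 h i j _ _ hij

theorem sorted_gap {C : List ℕ} (h : C.Pairwise (· < ·)) {i : ℕ} (hi : i < C.length) :
    i ≤ C[i] := by
  induction i with
  | zero => omega
  | succ i ih =>
    have := sorted_getElem h hi (Nat.lt_succ_self i)
    have := ih (by omega)
    omega

theorem getD_cases (C : List ℕ) (i d : ℕ) :
    (∃ h : i < C.length, C.getD i d = C[i]) ∨ (C.length ≤ i ∧ C.getD i d = d) := by
  by_cases h : i < C.length
  · exact Or.inl ⟨h, by simp [h]⟩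
  · exact Or.inr ⟨by omega, by simp [not_lt.1 h]⟩

theorem st_strict {k m : ℕ} {C : List ℕ} (h : C.Pairwise (· < ·)) :
    StrictMono (st (k := k) m C) := by
  intro i j hij
  have hij' : (i : ℕ) < j := hij
  simp only [st]
  rcases getD_cases C i (m + i) with ⟨h1, e1⟩ | ⟨h1, e1⟩ <;>
  rcases getD_cases C j (m + j) with ⟨h2, e2⟩ | ⟨h2, e2⟩ <;> rw [e1, e2]
  · have := sorted_getElem h h2 hij'
    omega
  all_goals omega

theorem le_st {k m : ℕ} {C : List ℕ} (h : C.Pairwise (· < ·)) :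
    (fun i : Fin k => (i : ℕ)) ≤ st m C := by
  intro i
  simp only [st]
  rcases getD_cases C i (m + i) with ⟨h1, e1⟩ | ⟨h1, e1⟩ <;> rw [e1]
  · have := sorted_gap h h1
    omega
  · omega

theorem st_le {k m : ℕ} (C : List ℕ) : st m C ≤ (fun i : Fin k => m + (i : ℕ)) :=
  fun _ => min_le_right _ _

theorem Dom_getD : ∀ (C D : List ℕ) (i d : ℕ), Dom C D → min (C.getD i d) d ≤ min (D.getD i d) d
  | C, [], i, d, _ => by simp
  | [], _ :: _, _, _, h => h.elim
  | a :: C, b :: D, 0, d, h => by simp only [List.getD_cons_zero]; have := h.1; omega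
  | a :: C, b :: D, i + 1, d, h => by
    simp only [List.getD_cons_succ]; exact Dom_getD C D i d h.2

theorem st_hit {k m : ℕ} {C : List ℕ} (h : C.Pairwise (· < ·)) {i : ℕ} (hi : i < C.length)
    (hik : i < k) (hj : C[i] < k + m) : hit C[i] (st (k := k) m C) = 1 := by
  by_cases hc : C[i] ≤ m + i
  · refine hit_of ⟨i, hik⟩ ?_
    simp only [st]
    rcases getD_cases C i (m + i) with ⟨h1, e1⟩ | ⟨h1, e1⟩
    · rw [e1]; omega
    · omega
  · refine hit_of ⟨C[i] - m, by omega⟩ ?_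
    simp only [st]
    rcases getD_cases C (C[i] - m) (m + (C[i] - m)) with ⟨h1, e1⟩ | ⟨h1, e1⟩
    · rw [e1]
      have := sorted_getElem h h1 (show i < C[i] - m by omega)
      omega
    · rw [e1]; omega

theorem W_const {k : ℕ} {S : Fin k → ℕ} (hS : StrictMono S) : ∀ w : List ℕ,
    W w S S ((w.map fun x => hit x S).sum)
  | [] => ⟨le_rfl, by simp⟩
  | x :: w => ⟨S, _, hS, le_rfl, W_const hS w, by simp⟩

theorem cnt_take : ∀ (C : List ℕ) (k j : ℕ), C.Pairwise (· < ·) →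
    cnt (C.take k) j = min k (cnt C j)
  | [], k, j, _ => by simp [cnt]
  | a :: C, 0, j, _ => by simp [cnt]
  | a :: C, k + 1, j, h => by
    rw [List.pairwise_cons] at h
    have ih := cnt_take C k j h.2
    have e : ∀ D : List ℕ, cnt (a :: D) j = cnt D j + (if a < j then 1 else 0) := fun D => by
      simp [cnt, List.countP_cons]
    rw [List.take_succ_cons, e, e, ih]
    split_ifs with ha
    · omega
    · have : cnt C j = 0 := by
        simp only [cnt, List.countP_eq_zero, decide_eq_true_eq]
        intro x hx
        have := h.1 x hx
        omega
      omega

theorem sum_hit_ge (S : ℕ → ℕ) (j : ℕ) : ∀ C : List ℕ, (∀ x ∈ C, x < j → 1 ≤ S x) →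
    cnt C j ≤ (C.map S).sum
  | [], _ => by simp [cnt]
  | a :: C, h => by
    have ih := sum_hit_ge S j C fun x hx => h x (List.mem_cons_of_mem _ hx)
    have e : cnt (a :: C) j = cnt C j + (if a < j then 1 else 0) := by
      simp [cnt, List.countP_cons]
    rw [e, List.map_cons, List.sum_cons]
    split_ifs with ha
    · have := h a (by simp) ha
      omega
    · omega

theorem col_lower {k m : ℕ} {C : List ℕ} (h : C.Pairwise (· < ·)) :
    min k (cnt C (k + m)) ≤ (C.reverse.map fun x => hit x (st (k := k) m C)).sum := by
  rw [← cnt_take C k _ h, List.map_reverse, List.sum_reverse]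
  refine (sum_hit_ge (fun x => hit x (st (k := k) m C)) (k + m) (C.take k) ?_).trans ?_
  · intro x hx hlt
    obtain ⟨i, hi, rfl⟩ := List.mem_iff_getElem.1 hx
    rw [List.getElem_take] at hlt ⊢
    rw [List.length_take] at hi
    exact (st_hit h (by omega) (by omega) hlt).ge
  · generalize (fun x => hit x (st (k := k) m C)) = S
    conv_rhs => rw [← List.take_append_drop k C]
    rw [List.map_append, List.sum_append]
    omega

theorem FF_lower' {k m : ℕ} : ∀ (T : List (List ℕ)), Tab T →
    W (tw T) (st (k := k) m (T.headD [])) (fun i => m + (i : ℕ)) (FF T k (k + m))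
  | [], _ => ⟨st_le _, by simp [FF]⟩
  | C :: T, h => by
    have e : tw (C :: T) = C.reverse ++ tw T := by simp [tw]
    rw [e, W_append]
    have ih := FF_lower' (k := k) (m := m) T h.2.2.2
    refine ⟨st m C, _, _, W_const (st_strict h.1) _,
      W_mono _ (fun i => Dom_getD C _ i (m + i) h.2.2.1) le_rfl ih, ?_⟩
    have := col_lower (k := k) (m := m) h.1
    have : FF (C :: T) k (k + m) = min k (cnt C (k + m)) + FF T k (k + m) := by simp [FF]
    omega

theorem W_iff_FF {k m : ℕ} (T : List (List ℕ)) (hT : Tab T) (v : ℕ) :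
    W (tw T) (fun i : Fin k => (i : ℕ)) (fun i => m + (i : ℕ)) v ↔ v ≤ FF T k (k + m) := by
  constructor
  · exact FF_upper T _ _ v hT (fun i => le_rfl)
  · intro hv
    refine W_mono _ (le_st ?_) hv (FF_lower' T hT)
    cases T with
    | nil => simp
    | cons C T => exact hT.1

theorem Dom_cnt : ∀ (C D : List ℕ) (j : ℕ), Dom C D → cnt D j ≤ cnt C j
  | C, [], j, _ => by simp [cnt]
  | [], _ :: _, _, h => h.elim
  | a :: C, b :: D, j, h => by
    have ih := Dom_cnt C D j h.2
    have := h.1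
    have e : ∀ (a : ℕ) (D : List ℕ), cnt (a :: D) j = cnt D j + (if a < j then 1 else 0) :=
      fun a D => by simp [cnt, List.countP_cons]
    rw [e, e]
    split_ifs <;> omega

theorem Tab_cnt : ∀ (T : List (List ℕ)) (j : ℕ), Tab T → ∀ C ∈ T, cnt C j ≤ cnt (T.headD []) j
  | [], _, _, C, hC => by simp at hC
  | D :: T, j, h, C, hC => by
    rcases List.mem_cons.1 hC with rfl | hC
    · exact le_rfl
    · exact (Tab_cnt T j h.2.2.2 C hC).trans (Dom_cnt _ _ _ h.2.2.1)

theorem FF_stable (T : List (List ℕ)) (s j : ℕ) (h : ∀ C ∈ T, cnt C j ≤ s) :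
    FF T (s + 1) j = FF T s j := by
  unfold FF
  congr 1
  refine List.map_congr_left fun C hC => ?_
  have := h C hC
  omega

theorem FF_mono (T : List (List ℕ)) (s j : ℕ) : FF T s j ≤ FF T (s + 1) j := by
  unfold FF
  exact List.sum_le_sum fun C _ => by omega

theorem cnt_le {C : List ℕ} (h : C.Pairwise (· < ·)) (j : ℕ) : cnt C j ≤ j := by
  have h1 : (C.filter fun x => decide (x < j)).Nodup := (h.imp ne_of_lt).filter _
  have h2 : (C.filter fun x => decide (x < j)).toFinset ⊆ Finset.range j := by
    intro x hx; simp at hx; simpa using hx.2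
  have := Finset.card_le_card h2
  rw [List.toFinset_card_of_nodup h1, Finset.card_range] at this
  rwa [cnt, List.countP_eq_length_filter]

theorem first_col {C C' : List ℕ} {T T' : List (List ℕ)} {n : ℕ} (h : Tab (C :: T))
    (h' : Tab (C' :: T'))
    (hF : ∀ k j, k ≤ j → j ≤ n → FF (C :: T) k j = FF (C' :: T') k j) (j : ℕ) (hj : j ≤ n) :
    cnt C' j ≤ cnt C j := by
  by_contra hc
  have hle := cnt_le h'.1 j
  have e1 := FF_stable (C :: T) (cnt C j) j (Tab_cnt _ j h)
  have e2 := hF (cnt C j) j (by omega) hj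
  have e3 := hF (cnt C j + 1) j (by omega) hj
  have e4 := FF_mono T' (cnt C j) j
  have e5 : ∀ k, FF (C' :: T') k j = min k (cnt C' j) + FF T' k j := fun k => by simp [FF]
  rw [e5] at e2 e3
  omega

theorem col_eq {C C' : List ℕ} {n : ℕ} (h : C.Pairwise (· < ·)) (h' : C'.Pairwise (· < ·))
    (hn : ∀ x ∈ C, x < n) (hn' : ∀ x ∈ C', x < n) (hc : ∀ j ≤ n, cnt C j = cnt C' j) : C = C' := by
  have key : ∀ (C : List ℕ) x, cnt C (x + 1) = cnt C x + C.count x := by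
    intro C x
    induction C with
    | nil => simp [cnt]
    | cons a C ih =>
      have e : ∀ j, cnt (a :: C) j = cnt C j + (if a < j then 1 else 0) :=
        fun j => by simp [cnt, List.countP_cons]
      rw [e, e, List.count_cons, ih]
      by_cases h1 : a = x
      · subst h1; simp; omega
      · have : (a == x) = false := by simp [h1]
        rw [this]
        simp only [Bool.false_eq_true, if_false]
        split_ifs <;> omega
  have hp : C.Perm C' := by
    rw [List.perm_iff_count]
    intro x
    by_cases hx : x < n
    · have := key C x
      have := key C' x
      have := hc x hx.le
      have := hc (x + 1) hx
      omega
    · rw [List.count_eq_zero_of_not_mem fun h => hx (hn x h),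
        List.count_eq_zero_of_not_mem fun h => hx (hn' x h)]
  exact hp.eq_of_pairwise (fun a b _ _ h1 h2 => absurd h1 (lt_asymm h2)) h h'

theorem FF_inj {n : ℕ} : ∀ (T T' : List (List ℕ)), Tab T → Tab T' → (∀ C ∈ T, ∀ x ∈ C, x < n) →
    (∀ C ∈ T', ∀ x ∈ C, x < n) → (∀ k j, k ≤ j → j ≤ n → FF T k j = FF T' k j) → T = T'
  | [], [], _, _, _, _, _ => rfl
  | C :: T, [], h, _, hn, _, hF => by
    exfalso
    obtain ⟨a, s, hs⟩ := List.exists_cons_of_ne_nil h.2.1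
    have ha : a < n := hn C (by simp) a (by simp [hs])
    have := hF 1 n (by omega) le_rfl
    simp [FF, hs, cnt, ha] at this
  | [], C :: T, _, h, _, hn, hF => by
    exfalso
    obtain ⟨a, s, hs⟩ := List.exists_cons_of_ne_nil h.2.1
    have ha : a < n := hn C (by simp) a (by simp [hs])
    have := hF 1 n (by omega) le_rfl
    simp [FF, hs, cnt, ha] at this
    omega
  | C :: T, C' :: T', h, h', hn, hn', hF => by
    have hC : C = C' := col_eq h.1 h'.1 (hn C (by simp)) (hn' C' (by simp)) fun j hj =>
      le_antisymm (first_col h' h (fun k j a b => (hF k j a b).symm) j hj) (first_col h h' hF j hj)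
    subst hC
    congr 1
    refine FF_inj T T' h.2.2.2 h'.2.2.2 (fun D hD => hn D (List.mem_cons_of_mem _ hD))
      (fun D hD => hn' D (List.mem_cons_of_mem _ hD)) fun k j a b => ?_
    have := hF k j a b
    simpa [FF] using this

theorem tab_inj {n : ℕ} (T T' : List (List ℕ)) (h : Tab T) (h' : Tab T')
    (hn : ∀ C ∈ T, ∀ x ∈ C, x < n) (hn' : ∀ C ∈ T', ∀ x ∈ C, x < n)
    (hW : ∀ k m, k + m ≤ n → ∀ v, W (tw T) (fun i : Fin k => (i : ℕ)) (fun i => m + (i : ℕ)) v ↔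
      W (tw T') (fun i : Fin k => (i : ℕ)) (fun i => m + (i : ℕ)) v) : T = T' := by
  refine FF_inj T T' h h' hn hn' fun k j hkj hj => ?_
  obtain ⟨m, rfl⟩ := Nat.exists_eq_add_of_le hkj
  have := hW k m hj
  simp only [W_iff_FF T h, W_iff_FF T' h'] at this
  exact le_antisymm ((this _).1 le_rfl) ((this _).2 le_rfl)

end Weights

end PlacticId

namespace PlacticId

theorem W_to_time {k : ℕ} : ∀ (w : List ℕ) (P Q : Fin k → ℕ) (v : ℕ), StrictMono Q → W w P Q v →
    ∃ σ : ℕ → Fin k → ℕ, (∀ s, StrictMono (σ s)) ∧ Monotone σ ∧ (∀ s, P ≤ σ s) ∧ (∀ s, σ s ≤ Q) ∧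
      v ≤ ∑ s ∈ Finset.range w.length, hit (w.getD s 0) (σ s)
  | [], P, Q, v, hQ, h => ⟨fun _ => Q, fun _ => hQ, monotone_const, fun _ => h.1, fun _ => le_rfl,
      by simpa using h.2⟩
  | x :: w, P, Q, v, hQ, ⟨S, v', h1, h2, h3, h4⟩ => by
    obtain ⟨σ, a1, a2, a3, a4, a5⟩ := W_to_time w S Q v' hQ h3
    have hS : ∀ s, S ≤ (fun s => Nat.casesOn s S σ : ℕ → Fin k → ℕ) s := by
      intro s; cases s with
      | zero => exact le_rfl
      | succ s => exact a3 s
    refine ⟨fun s => Nat.casesOn s S σ, ?_, ?_, fun s => h2.trans (hS s), ?_, ?_⟩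
    · intro s; cases s with
      | zero => exact h1
      | succ s => exact a1 s
    · refine monotone_nat_of_le_succ fun s => ?_
      cases s with
      | zero => exact hS 1
      | succ s => exact a2 (Nat.le_succ s)
    · intro s; cases s with
      | zero => exact (a3 0).trans (a4 0)
      | succ s => exact a4 s
    · rw [List.length_cons, Finset.sum_range_succ']
      simp only [List.getD_cons_succ, List.getD_cons_zero]
      show v ≤ _ + hit x S
      omega

theorem time_to_W {k : ℕ} : ∀ (w : List ℕ) (P Q : Fin k → ℕ) (σ : ℕ → Fin k → ℕ),
    (∀ s, StrictMono (σ s)) → Monotone σ → P ≤ σ 0 → P ≤ Q → (∀ s, σ s ≤ Q) →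
    W w P Q (∑ s ∈ Finset.range w.length, hit (w.getD s 0) (σ s))
  | [], P, Q, σ, _, _, h, h', _ => ⟨h', by simp⟩
  | x :: w, P, Q, σ, h1, h2, h3, _, h4 => by
    refine ⟨σ 0, _, h1 0, h3, time_to_W w (σ 0) Q (fun s => σ (s + 1)) (fun s => h1 _)
      (fun a b h => h2 (by omega)) (h2 (by omega)) (h4 0) (fun s => h4 _), ?_⟩
    rw [List.length_cons, Finset.sum_range_succ']
    simp only [List.getD_cons_succ, List.getD_cons_zero]
    omega

/-- cells of the grid -/
abbrev Cell (k m : ℕ) := (Fin k)ᵒᵈ × Fin m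

/-- gain of a cell on a letter, depends only on the diagonal -/
def gam (z y : ℕ) : ℤ := (if y = z + 1 then 1 else 0) - (if y = z then 1 else 0)

/-- diagonal of a cell -/
def dg {k m : ℕ} (x : Cell k m) : ℕ := (OrderDual.ofDual x.1 : Fin k) + (x.2 : ℕ)

theorem tele (i y d : ℕ) : ∑ p ∈ Finset.range d, gam (i + p) y =
    (if y = i + d then 1 else 0) - (if y = i then 1 else 0) := by
  induction d with
  | zero => simp
  | succ d ih =>
    rw [Finset.sum_range_succ, ih]
    simp only [gam, add_assoc]
    ring

theorem tele_row (i y m σ : ℕ) (h1 : i ≤ σ) (h2 : σ ≤ m + i) :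
    ((if σ = y then 1 else 0 : ℕ) : ℤ) = (if i = y then 1 else 0) +
      ∑ p : Fin m, (if i + (p : ℕ) < σ then gam (i + p) y else 0) := by
  rw [Fin.sum_univ_eq_sum_range (fun p => if i + p < σ then gam (i + p) y else 0) m,
    ← Finset.sum_filter]
  have : (Finset.range m).filter (fun p => i + p < σ) = Finset.range (σ - i) := by
    ext p; simp only [Finset.mem_filter, Finset.mem_range]; omega
  rw [this, tele]
  have e : i + (σ - i) = σ := by omega
  rw [e]
  push_cast
  simp only [eq_comm (a := y)]
  ring

theorem hit_sum {k : ℕ} {S : Fin k → ℕ} (hS : StrictMono S) (y : ℕ) :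
    hit y S = ∑ i, if S i = y then 1 else 0 := by
  rw [← Finset.card_filter]
  rcases hit_cases y S with ⟨h, h'⟩ | ⟨h, i, hi⟩
  · rw [h]; symm
    rw [Finset.card_eq_zero, Finset.filter_eq_empty_iff]
    exact fun i _ => h' i
  · rw [h]; symm
    rw [Finset.card_eq_one]
    refine ⟨i, ?_⟩
    ext j
    simp only [Finset.mem_filter, Finset.mem_univ, true_and, Finset.mem_singleton]
    constructor
    · intro hj; exact hS.injective (hj.trans hi.symm)
    · rintro rfl; exact hi

theorem hit_formula {k m : ℕ} {S : Fin k → ℕ} (hS : StrictMono S) (h1 : ∀ i : Fin k, (i : ℕ) ≤ S i)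
    (h2 : ∀ i : Fin k, S i ≤ m + i) (B : Cell k m → Prop) [DecidablePred B]
    (hB : ∀ (i : Fin k) (p : Fin m), (i : ℕ) + p < S i ↔ B (OrderDual.toDual i, p)) (y : ℕ) :
    (hit y S : ℤ) = (∑ i : Fin k, if (i : ℕ) = y then 1 else 0) +
      ∑ x : Cell k m, if B x then gam (dg x) y else 0 := by
  rw [hit_sum hS, Nat.cast_sum, Fintype.sum_prod_type]
  have : ∑ x : (Fin k)ᵒᵈ, ∑ p : Fin m, (if B (x, p) then gam (dg (x, p)) y else 0) =
      ∑ i : Fin k, ∑ p : Fin m, (if (i : ℕ) + p < S i then gam (i + p) y else 0) := by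
    refine Finset.sum_bij (fun x _ => OrderDual.ofDual x) (by simp) (fun a _ b _ h => h)
      (fun i _ => ⟨OrderDual.toDual i, by simp, rfl⟩) fun x _ => ?_
    refine Finset.sum_congr rfl fun p _ => ?_
    have := hB (OrderDual.ofDual x) p
    rw [OrderDual.toDual_ofDual] at this
    simp only [this, dg]
  rw [this, ← Finset.sum_add_distrib]
  exact Finset.sum_congr rfl fun i _ => tele_row i y m (S i) (h1 i) (h2 i)

/-- value of a cell time function -/
def val {k m : ℕ} (y : ℕ → ℕ) (N : ℕ) (T : Cell k m → ℕ) : ℤ :=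
  ∑ s ∈ Finset.range N, ((∑ i : Fin k, if (i : ℕ) = y s then 1 else 0) +
    ∑ x : Cell k m, if T x ≤ s then gam (dg x) (y s) else 0)

theorem W_to_cell {k m : ℕ} (w : List ℕ) (v : ℕ)
    (h : W w (fun i : Fin k => (i : ℕ)) (fun i => m + (i : ℕ)) v) :
    ∃ T : Cell k m → ℕ, Monotone T ∧ (∀ x, T x ≤ w.length) ∧
      (v : ℤ) ≤ val (fun s => w.getD s 0) w.length T := by
  obtain ⟨σ, a1, a2, a3, a4, a5⟩ := W_to_time w _ _ v
    (fun i j hij => by have : (i : ℕ) < j := hij; show m + (i : ℕ) < m + j; omega) h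
  refine ⟨fun x => ((Finset.range w.length).filter fun s => σ s (OrderDual.ofDual x.1) ≤ dg x).card,
    ?_, ?_, ?_⟩
  · intro x y hxy
    refine Finset.card_le_card fun s hs => ?_
    simp only [Finset.mem_filter] at hs ⊢
    refine ⟨hs.1, ?_⟩
    have h1 : OrderDual.ofDual y.1 ≤ OrderDual.ofDual x.1 := hxy.1
    have h2 : (x.2 : ℕ) ≤ y.2 := hxy.2
    have h3 := gap (a1 s) h1
    have h1' : ((OrderDual.ofDual y.1 : Fin k) : ℕ) ≤ (OrderDual.ofDual x.1 : Fin k) := h1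
    have h4 := hs.2
    simp only [dg] at h4 ⊢
    omega
  · intro x
    exact (Finset.card_filter_le _ _).trans (by simp)
  · refine le_trans (Int.ofNat_le.2 a5) (le_of_eq ?_)
    rw [Nat.cast_sum]
    refine Finset.sum_congr rfl fun s hs => ?_
    refine hit_formula (a1 s) (fun i => ple (a3 s) i) (fun i => ple (a4 s) i) _ (fun i p => ?_) _
    have hd : dg (OrderDual.toDual i, p) = (i : ℕ) + p := rfl
    constructor
    · intro h
      have : (Finset.range w.length).filter (fun s => σ s i ≤ dg (OrderDual.toDual i, p)) ⊆ Finset.range s := by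
        intro r hr
        simp only [Finset.mem_filter, Finset.mem_range] at hr ⊢
        by_contra hc
        have := ple (a2 (not_lt.1 hc)) i
        omega
      exact (Finset.card_le_card this).trans (by simp)
    · intro h
      by_contra hc
      have : Finset.range (s + 1) ⊆ (Finset.range w.length).filter (fun s => σ s i ≤ dg (OrderDual.toDual i, p)) := by
        intro r hr
        simp only [Finset.mem_filter, Finset.mem_range] at hr hs ⊢
        have := ple (a2 (Nat.lt_succ_iff.1 hr)) i
        omega
      have := Finset.card_le_card this
      rw [Finset.card_range] at this
      exact absurd (this.trans h) (by omega)

theorem cell_to_W {k m : ℕ} (w : List ℕ) (v : ℕ) (T : Cell k m → ℕ) (hT : Monotone T)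
    (hv : (v : ℤ) ≤ val (fun s => w.getD s 0) w.length T) :
    W w (fun i : Fin k => (i : ℕ)) (fun i => m + (i : ℕ)) v := by
  let c : ℕ → Fin k → ℕ := fun s i =>
    (Finset.univ.filter fun p : Fin m => T (OrderDual.toDual i, p) ≤ s).card
  let σ : ℕ → Fin k → ℕ := fun s i => i + c s i
  have hcm : ∀ s i, c s i ≤ m := fun s i => (Finset.card_le_univ _).trans (by simp)
  have hs : ∀ s, StrictMono (σ s) := by
    intro s i j hij
    have hij' : (i : ℕ) < j := hij
    have : c s i ≤ c s j := by
      refine Finset.card_le_card fun p hp => ?_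
      simp only [Finset.mem_filter, Finset.mem_univ, true_and] at hp ⊢
      refine le_trans (hT ?_) hp
      exact ⟨show i ≤ j from hij.le, le_rfl⟩
    simp only [σ]
    omega
  have hm : Monotone σ := by
    intro s r hsr i
    have : c s i ≤ c r i := by
      refine Finset.card_le_card fun p hp => ?_
      simp only [Finset.mem_filter, Finset.mem_univ, true_and] at hp ⊢
      omega
    simp only [σ]
    omega
  have h1 : ∀ (s : ℕ) (i : Fin k), (i : ℕ) ≤ σ s i := fun s i => by simp only [σ]; omega
  have h2 : ∀ (s : ℕ) (i : Fin k), σ s i ≤ m + i := fun s i => by have := hcm s i; simp only [σ]; omega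
  have key := time_to_W w (fun i : Fin k => (i : ℕ)) (fun i => m + (i : ℕ)) σ hs hm (h1 0)
    (fun i => by simp) h2
  refine W_mono w le_rfl ?_ key
  rw [← Int.ofNat_le]
  refine hv.trans (le_of_eq ?_)
  show _ = ((_ : ℕ) : ℤ)
  rw [Nat.cast_sum]
  refine Finset.sum_congr rfl fun s _ => ?_
  symm
  refine hit_formula (hs s) (h1 s) (h2 s) _ (fun i p => ?_) _
  simp only [σ, add_lt_add_iff_left]
  constructor
  · intro h
    by_contra hc
    have : (Finset.univ.filter fun p : Fin m => T (OrderDual.toDual i, p) ≤ s) ⊆ Finset.Iio p := by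
      intro r hr
      simp only [Finset.mem_filter, Finset.mem_univ, true_and, Finset.mem_Iio] at hr ⊢
      by_contra hc'
      have := hT (show (OrderDual.toDual i, p) ≤ (OrderDual.toDual i, r) from
        ⟨le_rfl, not_lt.1 hc'⟩)
      omega
    have := Finset.card_le_card this
    rw [Fin.card_Iio] at this
    simp only [c] at h
    omega
  · intro h
    have : Finset.Iic p ⊆ (Finset.univ.filter fun p : Fin m => T (OrderDual.toDual i, p) ≤ s) := by
      intro r hr
      simp only [Finset.mem_filter, Finset.mem_univ, true_and, Finset.mem_Iic] at hr ⊢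
      exact (hT (show (OrderDual.toDual i, r) ≤ (OrderDual.toDual i, p) from ⟨le_rfl, hr⟩)).trans h
    have := Finset.card_le_card this
    rw [Fin.card_Iic] at this
    simp only [c]
    omega

end PlacticId

namespace PlacticId

theorem val_split {k m : ℕ} (y : ℕ → ℕ) (N : ℕ) (T : Cell k m → ℕ) (hT : ∀ x, T x ≤ N) :
    val y N T = (∑ s ∈ Finset.range N, ∑ i : Fin k, if (i : ℕ) = y s then (1 : ℤ) else 0) +
      ∑ x : Cell k m, (∑ s ∈ Finset.range N, gam (dg x) (y s) -
        ∑ s ∈ Finset.range (T x), gam (dg x) (y s)) := by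
  unfold val
  rw [Finset.sum_add_distrib, Finset.sum_comm (s := Finset.range N) (t := Finset.univ (α := Cell k m))]
  congr 1
  refine Finset.sum_congr rfl fun x _ => ?_
  rw [← Finset.sum_filter, ← Finset.sum_filter_add_sum_filter_not (Finset.range N)
    (fun s => T x ≤ s)]
  have : (Finset.range N).filter (fun s => ¬ T x ≤ s) = Finset.range (T x) := by
    ext s
    have := hT x
    simp only [Finset.mem_filter, Finset.mem_range]
    omega
  rw [this]
  ring

theorem sum_getD (h : ℕ → ℤ) : ∀ l : List ℕ,
    ∑ s ∈ Finset.range l.length, h (l.getD s 0) = (l.map h).sum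
  | [] => by simp
  | a :: l => by
    rw [List.length_cons, Finset.sum_range_succ', List.map_cons, List.sum_cons, ← sum_getD h l]
    simp only [List.getD_cons_succ, List.getD_cons_zero]
    ring

/-- the two blocks -/
def wd {α : Type*} (xs ys : List α) (b : Bool) : List α := if b then xs ++ ys else ys ++ xs

theorem wd_length {α : Type*} (xs ys : List α) (b : Bool) :
    (wd xs ys b).length = xs.length + ys.length := by
  cases b <;> simp [wd, add_comm]

theorem wd_sum (xs ys : List ℕ) (h : ℕ → ℤ) (b : Bool) :
    ((wd xs ys b).map h).sum = ((xs ++ ys).map h).sum := by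
  cases b <;> simp [wd, add_comm]

theorem flat_length {α : Type*} (xs ys : List α) (es : List Bool) :
    ((es.map (wd xs ys)).flatten).length = es.length * (xs.length + ys.length) := by
  induction es with
  | nil => simp
  | cons e es ih => simp only [List.map_cons, List.flatten_cons, List.length_append, ih, wd_length,
      List.length_cons]; ring

theorem flat_getD (xs ys : List ℕ) (hl : 0 < xs.length + ys.length) : ∀ (es : List Bool) (t s : ℕ),
    t < es.length → s < xs.length + ys.length →
    ((es.map (wd xs ys)).flatten).getD (t * (xs.length + ys.length) + s) 0 =
      (wd xs ys (es.getD t true)).getD s 0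
  | [], t, s, h, _ => by simp at h
  | e :: es, 0, s, _, hs => by
    simp only [List.map_cons, List.flatten_cons, zero_mul, zero_add, List.getD_cons_zero]
    rw [List.getD_append]
    rw [wd_length]; exact hs
  | e :: es, t + 1, s, h, hs => by
    simp only [List.map_cons, List.flatten_cons, List.getD_cons_succ]
    rw [List.getD_append_right, wd_length]
    · have : (t + 1) * (xs.length + ys.length) + s - (xs.length + ys.length) =
        t * (xs.length + ys.length) + s := by
        rw [add_mul, one_mul]; omega
      rw [this]
      exact flat_getD xs ys hl es t s (by simpa using h) hs
    · rw [wd_length, add_mul, one_mul]; omega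

theorem block_sum (xs ys : List ℕ) (hl : 0 < xs.length + ys.length) (es : List Bool) (h : ℕ → ℤ) :
    ∀ t : ℕ, t ≤ es.length →
    ∑ s ∈ Finset.range (t * (xs.length + ys.length)), h (((es.map (wd xs ys)).flatten).getD s 0) =
      t * ((xs ++ ys).map h).sum := by
  intro t
  induction t with
  | zero => simp
  | succ t ih =>
    intro ht
    rw [add_mul, one_mul, Finset.sum_range_add, ih (by omega)]
    have : ∑ s ∈ Finset.range (xs.length + ys.length),
        h (((es.map (wd xs ys)).flatten).getD (t * (xs.length + ys.length) + s) 0) =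
        ((xs ++ ys).map h).sum := by
      rw [← wd_sum xs ys h (es.getD t true), ← sum_getD, wd_length]
      refine Finset.sum_congr rfl fun s hs => ?_
      rw [flat_getD xs ys hl es t s (by omega) (Finset.mem_range.1 hs)]
    rw [this]
    push_cast
    ring

theorem block_sum' (xs ys : List ℕ) (hl : 0 < xs.length + ys.length) (es : List Bool) (h : ℕ → ℤ)
    (t o : ℕ) (ho : o < xs.length + ys.length)
    (hT : t * (xs.length + ys.length) + o ≤ es.length * (xs.length + ys.length)) :
    ∑ s ∈ Finset.range (t * (xs.length + ys.length) + o),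
        h (((es.map (wd xs ys)).flatten).getD s 0) =
      t * ((xs ++ ys).map h).sum +
        ∑ s ∈ Finset.range o, h ((wd xs ys (es.getD t true)).getD s 0) := by
  have htN : t ≤ es.length := by
    by_contra hc
    have : (es.length + 1) * (xs.length + ys.length) ≤ t * (xs.length + ys.length) :=
      Nat.mul_le_mul_right _ (by omega)
    rw [add_mul] at this
    omega
  rw [Finset.sum_range_add, block_sum xs ys hl es h t htN]
  congr 1
  refine Finset.sum_congr rfl fun s hs => ?_
  have hs' := Finset.mem_range.1 hs
  rw [flat_getD xs ys hl es t s ?_ (by omega)]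
  by_contra hc
  have : t = es.length := by omega
  subst this
  omega

theorem val_blocks {k m : ℕ} (xs ys : List ℕ) (hl : 0 < xs.length + ys.length) (es : List Bool)
    (t o : Cell k m → ℕ) (ho : ∀ x, o x < xs.length + ys.length)
    (hT : ∀ x, t x * (xs.length + ys.length) + o x ≤ es.length * (xs.length + ys.length)) :
    val (fun s => ((es.map (wd xs ys)).flatten).getD s 0) ((es.map (wd xs ys)).flatten).length
      (fun x => t x * (xs.length + ys.length) + o x) =
    es.length * ((xs ++ ys).map fun y => ∑ i : Fin k, if (i : ℕ) = y then (1 : ℤ) else 0).sum +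
      (∑ x : Cell k m, (es.length : ℤ) * ((xs ++ ys).map (gam (dg x))).sum -
        (∑ x : Cell k m, (t x : ℤ) * ((xs ++ ys).map (gam (dg x))).sum +
        ∑ x : Cell k m, ∑ s ∈ Finset.range (o x), gam (dg x) ((wd xs ys (es.getD (t x) true)).getD s 0))) := by
  rw [flat_length, val_split _ _ _ hT]
  congr 1
  · exact block_sum xs ys hl es (fun y => ∑ i : Fin k, if (i : ℕ) = y then (1 : ℤ) else 0) _ le_rfl
  · rw [← Finset.sum_add_distrib, ← Finset.sum_sub_distrib]
    refine Finset.sum_congr rfl fun x _ => ?_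
    rw [block_sum xs ys hl es _ _ le_rfl, block_sum' xs ys hl es _ _ _ (ho x) (hT x)]

theorem rep_getD (q : List Bool) (R : List Bool) : ∀ (h j s : ℕ), j < h → s < q.length →
    ((List.replicate h q).flatten ++ R).getD (j * q.length + s) true = q.getD s true
  | 0, _, _, h, _ => by omega
  | h + 1, 0, s, _, hs => by
    simp only [List.replicate_succ, List.flatten_cons, zero_mul, zero_add, List.append_assoc]
    rw [List.getD_append _ _ _ _ hs]
  | h + 1, j + 1, s, hj, hs => by
    simp only [List.replicate_succ, List.flatten_cons, List.append_assoc]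
    rw [List.getD_append_right _ _ _ _ (by rw [add_mul]; omega)]
    have : (j + 1) * q.length + s - q.length = j * q.length + s := by rw [add_mul]; omega
    rw [this]
    exact rep_getD q R h j s (by omega) hs

theorem univ_of (q : List Bool) (d : ℕ) (hq : ∀ p : List Bool, p.length = d → p <:+: q)
    (e : ℤ → Bool) (lo : ℤ) (he : ∀ s : ℕ, s < q.length → e (lo + s) = q.getD s true) :
    Univ d e lo (lo + q.length) := by
  intro p
  obtain ⟨a, b, hab⟩ := hq ((List.range d).map p) (by simp)
  have hlen : a.length + d + b.length = q.length := by
    rw [← hab]; simp; omega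
  refine ⟨lo + a.length, by omega, by omega, fun i hi => ?_⟩
  have h1 := he (a.length + i) (by omega)
  push_cast at h1
  rw [← add_assoc] at h1
  rw [h1, ← hab, List.append_assoc, List.getD_append_right _ _ _ _ (by omega),
    List.getD_append _ _ _ _ (by simp; omega)]
  simp [hi]

/-- the exponent word -/
def ew (q : List Bool) (h : ℕ) (c : Bool) : List Bool :=
  (List.replicate h q).flatten ++ [c] ++ (List.replicate h q).flatten

theorem ew_length (q : List Bool) (h : ℕ) (c : Bool) : (ew q h c).length = 2 * h * q.length + 1 := by
  simp [ew]; ring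

theorem ew_ne (q : List Bool) (h : ℕ) (c c' : Bool) (z : ℕ) (hz : z ≠ h * q.length) :
    (ew q h c).getD z true = (ew q h c').getD z true := by
  have hlen : ((List.replicate h q).flatten).length = h * q.length := by simp
  unfold ew
  rw [List.append_assoc, List.append_assoc]
  rcases lt_or_gt_of_ne hz with hz | hz
  · rw [List.getD_append _ _ _ _ (by omega), List.getD_append _ _ _ _ (by omega)]
  · have hz' : ∀ d : Bool, [d].length ≤ z - ((List.replicate h q).flatten).length := fun d => by
      rw [hlen, List.length_singleton]; omega
    have hz2 : ((List.replicate h q).flatten).length ≤ z := by omega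
    rw [List.getD_append_right _ _ _ _ hz2, List.getD_append_right _ _ _ _ (hz' _),
      List.getD_append_right _ _ _ _ hz2, List.getD_append_right _ _ _ _ (hz' _)]
    simp

theorem ew_left (q : List Bool) (h : ℕ) (c : Bool) (j s : ℕ) (hj : j < h) (hs : s < q.length) :
    (ew q h c).getD (j * q.length + s) true = q.getD s true := by
  unfold ew
  rw [List.append_assoc]
  exact rep_getD q _ h j s hj hs

theorem ew_right (q : List Bool) (h : ℕ) (c : Bool) (j s : ℕ) (hj : j < h) (hs : s < q.length) :
    (ew q h c).getD (h * q.length + 1 + j * q.length + s) true = q.getD s true := by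
  unfold ew
  have hlen : ((List.replicate h q).flatten ++ [c]).length = h * q.length + 1 := by simp
  rw [List.getD_append_right _ _ _ _ (by omega), hlen]
  have : h * q.length + 1 + j * q.length + s - (h * q.length + 1) = j * q.length + s := by omega
  rw [this]
  simpa using rep_getD q [] h j s hj hs

theorem core_dir (n : ℕ) (hn : 1 ≤ n) (q : List Bool)
    (hq : ∀ p : List Bool, p.length = n - 1 → p <:+: q) (xs ys : List ℕ) (k m : ℕ)
    (hkm : k + m ≤ n) (c c' : Bool) (v : ℕ)
    (h : W (((ew q (n ^ 2 / 4) c).map (wd xs ys)).flatten) (fun i : Fin k => (i : ℕ))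
      (fun i => m + (i : ℕ)) v) :
    W (((ew q (n ^ 2 / 4) c').map (wd xs ys)).flatten) (fun i : Fin k => (i : ℕ))
      (fun i => m + (i : ℕ)) v := by
  rcases Nat.eq_zero_or_pos (xs.length + ys.length) with hl | hl
  · have e : ∀ es : List Bool, (es.map (wd xs ys)).flatten = [] := fun es => by
      rw [← List.length_eq_zero_iff, flat_length, hl, mul_zero]
    rw [e] at h ⊢
    exact h
  obtain ⟨T, hTm, hTN, hv⟩ := W_to_cell _ v h
  have hcard : Fintype.card (Cell k m) ≤ n ^ 2 / 4 := by
    have : Fintype.card (Cell k m) = k * m := by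
      rw [Fintype.card_prod, Fintype.card_orderDual, Fintype.card_fin, Fintype.card_fin]
    rw [this, Nat.le_div_iff_mul_le (by norm_num)]
    zify at hkm ⊢
    nlinarith [sq_nonneg ((k : ℤ) - m)]
  generalize n ^ 2 / 4 = r at *
  set l := xs.length + ys.length with hldef
  let g : Cell k m → ℤ := fun x => ((xs ++ ys).map (gam (dg x))).sum
  let e : ℤ → Bool := fun z => (ew q r c).getD z.toNat true
  have hN : (ew q r c).length = 2 * r * q.length + 1 := ew_length q r c
  have hN' : (ew q r c').length = 2 * r * q.length + 1 := ew_length q r c'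
  rw [flat_length, hN] at hTN
  have htl : ∀ x, T x / l * l + T x % l = T x := fun x => by
    rw [mul_comm]; exact Nat.div_add_mod _ _
  obtain ⟨t', h1, h2, h3, h4, h5, h6⟩ := opt (α := Cell k m) g (n - 1) e q.length (by omega)
    (fun D I hD hI hDI hJ => (ribbon k m (fun z => ((xs ++ ys).map (gam z)).sum) D I hD hI hDI g
      (fun x => rfl) hJ).trans (by omega)) r hcard
    (fun j hj => by
      have := univ_of q (n - 1) hq e (j * q.length) (fun s hs => by
        have := ew_left q r c j s hj hs
        simp only [e]
        rw [← this]
        congr 1)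
      convert this using 1
      ring)
    (fun j hj => by
      have := univ_of q (n - 1) hq e (r * q.length + 1 + j * q.length) (fun s hs => by
        have := ew_right q r c j s hj hs
        simp only [e]
        rw [← this]
        congr 1)
      convert this using 1
      ring)
    (fun x => ((T x / l : ℕ) : ℤ)) (fun x => ((T x % l : ℕ) : ℤ))
    (fun x y hxy => by
      have := hTm hxy
      have h1 := Nat.div_le_div_right (c := l) this
      rcases h1.lt_or_eq with h1 | h1
      · left; show ((T x / l : ℕ) : ℤ) < ((T y / l : ℕ) : ℤ); exact_mod_cast h1
      · right
        refine ⟨by show ((T x / l : ℕ) : ℤ) = ((T y / l : ℕ) : ℤ); exact_mod_cast h1, ?_⟩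
        show ((T x % l : ℕ) : ℤ) ≤ ((T y % l : ℕ) : ℤ)
        have a := htl x
        have b := htl y
        rw [h1] at a
        have : T x % l ≤ T y % l := by omega
        exact_mod_cast this)
    (fun x => by positivity)
    (fun x => by
      have : T x / l ≤ 2 * r * q.length + 1 := by
        refine Nat.div_le_of_le_mul ?_
        rw [mul_comm]; exact hTN x
      exact_mod_cast this)
  obtain ⟨t'', ht''⟩ : ∃ t'' : Cell k m → ℕ, ∀ x, t' x = (t'' x : ℤ) :=
    ⟨fun x => (t' x).toNat, fun x => (Int.toNat_of_nonneg (h3 x)).symm⟩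
  have ho : ∀ x, T x % l < l := fun x => Nat.mod_lt _ hl
  have hTN' : ∀ x, t'' x * l + T x % l ≤ (2 * r * q.length + 1) * l := by
    intro x
    have a := h4 x
    rw [ht'' x] at a
    rcases le_max_iff.1 a with a | a
    · have a' : t'' x ≤ 2 * r * q.length := by exact_mod_cast a
      have := Nat.mul_le_mul_right l a'
      have := ho x
      rw [add_mul, one_mul]
      omega
    · have a' : t'' x ≤ T x / l := by exact_mod_cast a
      have := Nat.mul_le_mul_right l a'
      have := htl x
      have : T x ≤ (2 * r * q.length + 1) * l := hTN x
      omega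
  have hmono : Monotone (fun x => t'' x * l + T x % l) := by
    intro x y hxy
    have a := h1 x y hxy
    simp only [ht''] at a
    show t'' x * l + T x % l ≤ t'' y * l + T y % l
    rcases a with a | ⟨a, b⟩
    · have a' : t'' x + 1 ≤ t'' y := by exact_mod_cast a
      have hA := Nat.mul_le_mul_right l a'
      rw [add_mul, one_mul] at hA
      have hB := ho x
      omega
    · have a' : t'' x = t'' y := by exact_mod_cast a
      have b' : T x % l ≤ T y % l := by exact_mod_cast b
      rw [a']
      omega
  refine cell_to_W _ v _ hmono ?_
  refine hv.trans ?_
  have v1 := val_blocks (k := k) (m := m) xs ys hl (ew q r c) (fun x => T x / l) (fun x => T x % l) ho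
    (fun x => by rw [hN]; simp only [← hldef, htl]; exact hTN x)
  have v2 := val_blocks (k := k) (m := m) xs ys hl (ew q r c') t'' (fun x => T x % l) ho
    (fun x => by rw [hN']; exact hTN' x)
  simp only [← hldef, htl] at v1
  simp only [← hldef] at v2
  rw [v2, v1, hN, hN']
  have hpre : ∀ x, (ew q r c').getD (t'' x) true = (ew q r c).getD (T x / l) true := by
    intro x
    have a := h5 x
    have b := h2 x
    rw [ht'' x] at a b
    simp only [e, Int.toNat_natCast] at b
    rw [← b]
    exact ew_ne q r c' c _ (by exact_mod_cast a)
  simp only [hpre]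
  have h6' : ∑ x, (t'' x : ℤ) * ((xs ++ ys).map (gam (dg x))).sum ≤
      ∑ x : Cell k m, ((T x / l : ℕ) : ℤ) * ((xs ++ ys).map (gam (dg x))).sum := by
    simp only [ht'', g] at h6
    exact h6
  linarith

theorem core (n : ℕ) (hn : 1 ≤ n) (q : List Bool)
    (hq : ∀ p : List Bool, p.length = n - 1 → p <:+: q) (xs ys : List ℕ) (k m : ℕ)
    (hkm : k + m ≤ n) (c c' : Bool) (v : ℕ) :
    W (((ew q (n ^ 2 / 4) c).map (wd xs ys)).flatten) (fun i : Fin k => (i : ℕ))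
      (fun i => m + (i : ℕ)) v ↔
    W (((ew q (n ^ 2 / 4) c').map (wd xs ys)).flatten) (fun i : Fin k => (i : ℕ))
      (fun i => m + (i : ℕ)) v :=
  ⟨core_dir n hn q hq xs ys k m hkm c c' v, core_dir n hn q hq xs ys k m hkm c' c v⟩

end PlacticId

namespace PlacticId

/-- the congruence given by equality of all chain weights -/
def wCon (n : ℕ) : Con (FreeMonoid (Fin n)) where
  r a b := ∀ (k : ℕ) (P Q : Fin k → ℕ) (v : ℕ),
    W (a.toList.map Fin.val) P Q v ↔ W (b.toList.map Fin.val) P Q v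
  iseqv := ⟨fun _ _ _ _ _ => Iff.rfl, fun h k P Q v => (h k P Q v).symm,
    fun h h' k P Q v => (h k P Q v).trans (h' k P Q v)⟩
  mul' := by
    intro a b c d h h' k P Q v
    simp only [FreeMonoid.toList_mul, List.map_append, W_append]
    simp only [h k, h' k]

theorem knuth_le (n : ℕ) : conGen (knuthRel n) ≤ wCon n := by
  refine Con.conGen_le.2 fun x y h => ?_
  rcases h with ⟨a, b, c, hab, hbc, rfl, rfl⟩ | ⟨a, b, c, hab, hbc, rfl, rfl⟩
  · intro k P Q v
    exact W_knuth1 hab hbc P Q v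
  · intro k P Q v
    exact W_knuth2 hab hbc P Q v

/-- generators -/
def gen {n : ℕ} (i : Fin n) : Plactic n := ((FreeMonoid.of i : FreeMonoid (Fin n)) : Plactic n)

theorem gen_prod {n : ℕ} (l : List (Fin n)) :
    (l.map gen).prod = ((FreeMonoid.ofList l : FreeMonoid (Fin n)) : Plactic n) := by
  induction l with
  | nil => rfl
  | cons a l ih => rw [List.map_cons, List.prod_cons, ih]; rfl

theorem gen_K1 {n : ℕ} (a b c : Fin n) (hab : a < b) (hbc : b ≤ c) :
    gen b * gen c * gen a = gen b * gen a * gen c :=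
  (Con.eq _).2 (ConGen.Rel.of _ _ (Or.inl ⟨a, b, c, hab, hbc, rfl, rfl⟩))

theorem gen_K2 {n : ℕ} (a b c : Fin n) (hab : a ≤ b) (hbc : b < c) :
    gen c * gen a * gen b = gen a * gen c * gen b :=
  (Con.eq _).2 (ConGen.Rel.of _ _ (Or.inr ⟨a, b, c, hab, hbc, rfl, rfl⟩))

theorem gen_W {n : ℕ} {l l' : List (Fin n)} (h : (l.map gen).prod = (l'.map gen).prod) (k : ℕ)
    (P Q : Fin k → ℕ) (v : ℕ) : W (l.map Fin.val) P Q v ↔ W (l'.map Fin.val) P Q v := by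
  rw [gen_prod, gen_prod] at h
  exact knuth_le n ((Con.eq _).1 h) k P Q v

theorem Dom_map {n : ℕ} : ∀ C D : List (Fin n), Dom C D → Dom (C.map Fin.val) (D.map Fin.val)
  | C, [], _ => Dom_nil _
  | [], _ :: _, h => h.elim
  | _ :: C, _ :: D, h => ⟨h.1, Dom_map C D h.2⟩

theorem Tab_map {n : ℕ} : ∀ T : List (List (Fin n)), Tab T → Tab (T.map (List.map Fin.val))
  | [], _ => trivial
  | C :: T, ⟨h1, h2, h3, h4⟩ => by
    refine ⟨?_, by simpa using h2, ?_, Tab_map T h4⟩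
    · rw [List.pairwise_map]; exact h1
    · have := Dom_map _ _ h3
      cases T with
      | nil => exact Dom_nil _
      | cons D T => exact this

theorem tw_map {n : ℕ} (T : List (List (Fin n))) :
    tw (T.map (List.map Fin.val)) = (tw T).map Fin.val := by
  unfold tw
  rw [List.map_flatten, List.map_map, List.map_map]
  congr 1
  refine List.map_congr_left fun C _ => ?_
  simp

theorem wd_map {n : ℕ} (xs ys : List (Fin n)) (es : List Bool) :
    ((es.map (wd xs ys)).flatten).map Fin.val =
      (es.map (wd (xs.map Fin.val) (ys.map Fin.val))).flatten := by
  rw [List.map_flatten, List.map_map]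
  congr 1
  refine List.map_congr_left fun b _ => ?_
  cases b <;> simp [wd]

theorem wd_prod {n : ℕ} (xs ys : List (Fin n)) (es : List Bool) :
    (((es.map (wd xs ys)).flatten).map gen).prod =
      (es.map fun c => if c then (xs.map gen).prod * (ys.map gen).prod else
        (ys.map gen).prod * (xs.map gen).prod).prod := by
  induction es with
  | nil => simp
  | cons b es ih =>
    simp only [List.map_cons, List.flatten_cons, List.map_append, List.prod_append, ih,
      List.prod_cons]
    cases b <;> simp [wd]

end PlacticId

/-- Theorem 4.1: with q containing every word of length n-1 over {a,b} as a factor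
(letters: `true` = a, `false` = b), h = ⌊n²/4⌋, u = qʰ a qʰ and v = qʰ b qʰ, the
plactic monoid of rank n satisfies u[a ↦ ab, b ↦ ba] = v[a ↦ ab, b ↦ ba];
equivalently, evaluating u and v under a ↦ XY, b ↦ YX gives equal elements. -/
theorem stmt_16 (n : ℕ) (hn : 1 ≤ n) (q : List Bool)
    (hq : ∀ p : List Bool, p.length = n - 1 → p <:+: q)
    (X Y : Plactic n) :
    (((List.replicate (n ^ 2 / 4) q).flatten ++ [true] ++
        (List.replicate (n ^ 2 / 4) q).flatten).map
          fun c => if c then X * Y else Y * X).prod =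
    (((List.replicate (n ^ 2 / 4) q).flatten ++ [false] ++
        (List.replicate (n ^ 2 / 4) q).flatten).map
          fun c => if c then X * Y else Y * X).prod := by 
  obtain ⟨x, rfl⟩ := Con.mk'_surjective (c := conGen (knuthRel n)) X
  obtain ⟨y, rfl⟩ := Con.mk'_surjective (c := conGen (knuthRel n)) Y
  have hx : Con.mk' (conGen (knuthRel n)) x = ((FreeMonoid.toList x).map PlacticId.gen).prod :=
    (PlacticId.gen_prod (FreeMonoid.toList x)).symm
  have hy : Con.mk' (conGen (knuthRel n)) y = ((FreeMonoid.toList y).map PlacticId.gen).prod :=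
    (PlacticId.gen_prod (FreeMonoid.toList y)).symm
  rw [hx, hy]
  have e1 := PlacticId.wd_prod (FreeMonoid.toList x) (FreeMonoid.toList y)
    (PlacticId.ew q (n ^ 2 / 4) true)
  have e2 := PlacticId.wd_prod (FreeMonoid.toList x) (FreeMonoid.toList y)
    (PlacticId.ew q (n ^ 2 / 4) false)
  refine e1.symm.trans (Eq.trans ?_ e2)
  obtain ⟨T, hT, hTu⟩ := PlacticId.exists_tab (PlacticId.gen (n := n)) PlacticId.gen_K1
    PlacticId.gen_K2 (((PlacticId.ew q (n ^ 2 / 4) true).map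
      (PlacticId.wd (FreeMonoid.toList x) (FreeMonoid.toList y))).flatten)
  obtain ⟨T', hT', hTv⟩ := PlacticId.exists_tab (PlacticId.gen (n := n)) PlacticId.gen_K1
    PlacticId.gen_K2 (((PlacticId.ew q (n ^ 2 / 4) false).map
      (PlacticId.wd (FreeMonoid.toList x) (FreeMonoid.toList y))).flatten)
  have hlt : ∀ T : List (List (Fin n)), ∀ C ∈ T.map (List.map Fin.val), ∀ z ∈ C, z < n := by
    intro T C hC z hz
    obtain ⟨D, -, rfl⟩ := List.mem_map.1 hC
    obtain ⟨i, -, rfl⟩ := List.mem_map.1 hz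
    exact i.2
  have key := PlacticId.tab_inj (n := n) _ _ (PlacticId.Tab_map T hT) (PlacticId.Tab_map T' hT')
    (hlt T) (hlt T') (fun k m hkm v => by
      rw [PlacticId.tw_map, PlacticId.tw_map, ← PlacticId.gen_W hTu, ← PlacticId.gen_W hTv,
        PlacticId.wd_map, PlacticId.wd_map]
      exact PlacticId.core n hn q hq _ _ k m hkm true false v)
  have hTT : T = T' :=
    List.map_injective_iff.2 (List.map_injective_iff.2 Fin.val_injective) key
  rw [hTu, hTv, hTT]
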